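/- Fix positive integers M1, M2, M3, an integer L ≥ 2, and a real r > 0. For i = 1, 2 and l = 1, ..., L, let H_{i,l} be mutually independent standard complex Gaussian random matrices of size M_{i+1}×M_i, and for ρ > 1 let C_{i,l}(ρ) = log det(I + (ρ/M_i) H_{i,l} H_{i,l}†). Define t_i(ρ) = min{ t ∈ ℤ, t ≥ 1 : Σ_{l=1}^{t} C_{i,l}(ρ) ≥ r·log ρ } (with t_i(ρ) = +∞ if no such t ≤ L exists). Then lim_{ρ→∞} log P( t_1(ρ) + t_2(ρ) > L ) / log ρ = − min{ l1·d^{(M1,M2)}(r/l1) + l2·d^{(M2,M3)}(r/l2) : l1, l2 ∈ ℤ, l1, l2 ≥ 0, l1 + l2 = L−1 }, where by convention 0·d^{(m,n)}(r/0) := 0. (Theorem 5: DMDT of the FBL ARQ protocol for a three-node MIMO multihop network under the short-term static channel assumption.) -/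

import Mathlib

open MeasureTheory ProbabilityTheory

/-- The point values of the diversity-multiplexing tradeoff:
`dmtPt m n k = (m - k) * (n - k)`. -/
noncomputable def dmtPt (m n k : ℕ) : ℝ := ((m : ℝ) - k) * ((n : ℝ) - k)

/-- The diversity-multiplexing tradeoff function `d^{(m,n)}` of an `m × n` MIMO channel:
the piecewise linear function connecting the points `(k, (m-k)(n-k))` for
`k = 0, 1, ..., min m n`, and equal to `0` for arguments `≥ min m n`. -/
noncomputable def dmt (m n : ℕ) (r : ℝ) : ℝ :=
  if ((min m n : ℕ) : ℝ) ≤ r then 0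
  else dmtPt m n ⌊r⌋₊ + (r - ⌊r⌋₊) * (dmtPt m n (⌊r⌋₊ + 1) - dmtPt m n ⌊r⌋₊)

/-- `l · d^{(m,n)}(r / l)` with the convention `0 · d^{(m,n)}(r/0) := 0`. -/
noncomputable def ldmtDiv (m n : ℕ) (r : ℝ) (l : ℕ) : ℝ :=
  if l = 0 then 0 else (l : ℝ) * dmt m n (r / l)

/-- The capacity `log det (I + (ρ / M) H Hᴴ)` of a MIMO channel with matrix `H`. -/
noncomputable def cap {a b : ℕ} (M : ℕ) (ρ : ℝ) (H : Matrix (Fin a) (Fin b) ℂ) : ℝ :=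
  Real.log ((1 + ((ρ / M : ℝ) : ℂ) • (H * H.conjTranspose)).det.re)

/-- The integer decoding time `min {t ∈ ℤ, 1 ≤ t ≤ L : Σ_{l=1}^t C_l ≥ R}`, equal to
`+∞` (the top element of `ℕ∞`) if no such `t ≤ L` exists.  The capacity increments are
`C : ℕ → ℝ`, zero-indexed: `C l` is the capacity of ARQ round `l + 1`. -/
noncomputable def decTimeST (L : ℕ) (C : ℕ → ℝ) (R : ℝ) : ℕ∞ :=
  sInf {t : ℕ∞ | ∃ n : ℕ, t = (n : ℕ∞) ∧ 1 ≤ n ∧ n ≤ L ∧ R ≤ ∑ l ∈ Finset.range n, C l}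


section MatrixPart

set_option linter.unusedSectionVars false
set_option linter.unusedSimpArgs false

open Matrix
open scoped ComplexOrder

/-- `Dg ρ A = det (1 + ρ A Aᴴ)`. -/
noncomputable def Dg {ι κ : Type*} [Fintype ι] [Fintype κ] [DecidableEq ι]
    (ρ : ℝ) (A : Matrix ι κ ℂ) : ℝ := (1 + (ρ : ℂ) • (A * Aᴴ)).det.re

theorem psd_one_le_det {ι : Type*} [Fintype ι] [DecidableEq ι] {Z : Matrix ι ι ℂ}
    (hZ : Z.PosSemidef) : 1 ≤ (1 + Z).det := by
  have h : (1 + Z).det = ∏ i, (1 + (hZ.1.eigenvalues i : ℂ)) := by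
    have hs := hZ.1.spectral_theorem
    rw [Unitary.conjStarAlgAut_apply] at hs
    have hU : (hZ.1.eigenvectorUnitary : Matrix ι ι ℂ) * star (hZ.1.eigenvectorUnitary : Matrix ι ι ℂ) = 1 :=
      Unitary.coe_mul_star_self _
    conv_lhs => rw [hs, mul_assoc, Matrix.det_one_add_mul_comm, mul_assoc, Unitary.coe_star_mul_self, mul_one]
    rw [← Matrix.diagonal_one, Matrix.diagonal_add, Matrix.det_diagonal]
    simp
  rw [h]
  have h2 : (∏ i, (1 + (hZ.1.eigenvalues i : ℂ))) = ((∏ i, (1 + hZ.1.eigenvalues i) : ℝ) : ℂ) := by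
    push_cast; rfl
  rw [h2]
  have h3 : (1 : ℝ) ≤ ∏ i, (1 + hZ.1.eigenvalues i) := by
    apply Finset.prod_induction _ (fun x : ℝ => 1 ≤ x)
    · intro a b ha hb; exact one_le_mul_of_one_le_of_one_le ha hb
    · exact le_refl _
    · intro i _
      have := hZ.eigenvalues_nonneg i
      linarith
  exact_mod_cast h3

theorem posDef_det_mono {ι : Type*} [Fintype ι] [DecidableEq ι] {X Y : Matrix ι ι ℂ}
    (hX : X.PosDef) (hY : Y.PosSemidef) : X.det ≤ (X + Y).det := by
  obtain ⟨B, hB⟩ : ∃ B : Matrix ι ι ℂ, X = Bᴴ * B := by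
    open scoped MatrixOrder in
    exact (CStarAlgebra.nonneg_iff_eq_star_mul_self (a := X)).1 (hX.posSemidef.nonneg)
  have hdet : X.det ≠ 0 := hX.det_pos.ne'
  have hBd : IsUnit B.det := by
    rw [isUnit_iff_ne_zero]; intro h; apply hdet; rw [hB, det_mul, h, mul_zero]
  have hBd' : IsUnit Bᴴ.det := by
    rw [det_conjTranspose]; exact hBd.star
  have e : X + Y = Bᴴ * (1 + (B⁻¹)ᴴ * Y * B⁻¹) * B := by
    have h1 : Bᴴ * (B⁻¹)ᴴ = 1 := by
      rw [← conjTranspose_mul, nonsing_inv_mul _ hBd, conjTranspose_one]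
    have h2 : B⁻¹ * B = 1 := nonsing_inv_mul _ hBd
    calc X + Y = Bᴴ * B + (Bᴴ * (B⁻¹)ᴴ) * Y * (B⁻¹ * B) := by rw [h1, h2, hB]; simp
      _ = _ := by simp only [mul_add, add_mul, mul_one, mul_assoc]
  have h3 := psd_one_le_det (hY.conjTranspose_mul_mul_same B⁻¹)
  have h4 : (X + Y).det = X.det * (1 + (B⁻¹)ᴴ * Y * B⁻¹).det := by
    rw [e, hB]; simp only [det_mul]; ring
  rw [h4]
  exact le_mul_of_one_le_right hX.det_pos.le h3

variable {ι κ : Type*} [Fintype ι] [Fintype κ] [DecidableEq ι] [DecidableEq κ]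

theorem psd_smul_mul_self {ρ : ℝ} (hρ : 0 ≤ ρ) (A : Matrix ι κ ℂ) :
    ((ρ : ℂ) • (A * Aᴴ)).PosSemidef := by
  apply (posSemidef_self_mul_conjTranspose A).smul
  exact_mod_cast hρ

theorem pd_one_add {ρ : ℝ} (hρ : 0 ≤ ρ) (A : Matrix ι κ ℂ) :
    (1 + (ρ : ℂ) • (A * Aᴴ)).PosDef :=
  PosDef.one.add_posSemidef (psd_smul_mul_self hρ A)

theorem one_le_Dg {ρ : ℝ} (hρ : 0 ≤ ρ) (A : Matrix ι κ ℂ) : 1 ≤ Dg ρ A := by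
  have := psd_one_le_det (psd_smul_mul_self hρ A)
  exact (Complex.le_def.1 this).1

theorem Dg_conjTranspose (ρ : ℝ) (A : Matrix ι κ ℂ) : Dg ρ Aᴴ = Dg ρ A := by
  unfold Dg
  rw [conjTranspose_conjTranspose, ← Matrix.smul_mul, det_one_add_mul_comm, Matrix.mul_smul]

theorem Dg_mul_le {ρ c : ℝ} (hρ : 0 ≤ ρ) (hc : 1 ≤ c) (B : Matrix ι ι ℂ) (A : Matrix ι κ ℂ)
    (hB : ((c : ℂ) • (1 : Matrix ι ι ℂ) - Bᴴ * B).PosSemidef) :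
    Dg ρ (B * A) ≤ c ^ Fintype.card κ * Dg ρ A := by
  rw [← Dg_conjTranspose, ← Dg_conjTranspose ρ A]
  unfold Dg
  simp only [conjTranspose_conjTranspose]
  have hc0 : (0 : ℝ) ≤ c := by linarith
  have hρ' : (0 : ℂ) ≤ (ρ : ℂ) := by exact_mod_cast hρ
  have pd := pd_one_add hρ (B * A)ᴴ
  rw [conjTranspose_conjTranspose] at pd
  have psd1 : ((ρ : ℂ) • (Aᴴ * ((c : ℂ) • (1 : Matrix ι ι ℂ) - Bᴴ * B) * A)).PosSemidef :=
    (hB.conjTranspose_mul_mul_same A).smul hρ'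
  have psd2 : (((c - 1 : ℝ) : ℂ) • (1 : Matrix κ κ ℂ)).PosSemidef := by
    apply PosSemidef.one.smul
    have : (0 : ℝ) ≤ c - 1 := by linarith
    exact_mod_cast this
  have h := posDef_det_mono pd (psd1.add psd2)
  have e : 1 + (ρ : ℂ) • ((B * A)ᴴ * (B * A)) +
      ((ρ : ℂ) • (Aᴴ * ((c : ℂ) • (1 : Matrix ι ι ℂ) - Bᴴ * B) * A) +
        ((c - 1 : ℝ) : ℂ) • (1 : Matrix κ κ ℂ)) = (c : ℂ) • (1 + (ρ : ℂ) • (Aᴴ * A)) := by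
    simp only [conjTranspose_mul, mul_sub, sub_mul, Matrix.mul_smul, Matrix.smul_mul, mul_one,
      smul_sub, smul_add, Complex.ofReal_sub, Complex.ofReal_one, sub_smul, one_smul, mul_assoc,
      Matrix.mul_assoc, Matrix.mul_sub, Matrix.sub_mul, Matrix.mul_one]
    rw [smul_comm (ρ : ℂ) (c : ℂ)]
    abel
  rw [e, det_smul] at h
  have h1 := (Complex.le_def.1 h).1
  have h2 : ((c : ℂ) ^ Fintype.card κ) = ((c ^ Fintype.card κ : ℝ) : ℂ) := by push_cast; rfl
  rw [h2, Complex.re_ofReal_mul] at h1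
  exact h1

theorem psd_of_entries (B : Matrix ι ι ℂ) (hB : ∀ i j, ‖B i j‖ ≤ 1) :
    (((Fintype.card ι ^ 2 + 1 : ℝ) : ℂ) • (1 : Matrix ι ι ℂ) - Bᴴ * B).PosSemidef := by
  apply PosSemidef.of_dotProduct_mulVec_nonneg
  · apply IsHermitian.sub
    · rw [IsHermitian, conjTranspose_smul, conjTranspose_one]
      simp
    · exact isHermitian_conjTranspose_mul_self B
  · intro x
    have key : ∀ y : ι → ℂ, star y ⬝ᵥ y = ((∑ i, ‖y i‖ ^ 2 : ℝ) : ℂ) := by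
      intro y
      simp only [dotProduct, Pi.star_apply, Complex.ofReal_sum, Complex.ofReal_pow]
      apply Finset.sum_congr rfl
      intro i _
      rw [RCLike.star_def, Complex.conj_mul']
    have e : star x ⬝ᵥ ((((Fintype.card ι ^ 2 + 1 : ℝ) : ℂ) • (1 : Matrix ι ι ℂ) - Bᴴ * B) *ᵥ x)
        = (((Fintype.card ι ^ 2 + 1) * ∑ i, ‖x i‖ ^ 2 - ∑ i, ‖(B *ᵥ x) i‖ ^ 2 : ℝ) : ℂ) := by
      rw [sub_mulVec, dotProduct_sub, smul_mulVec, one_mulVec, dotProduct_smul, key,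
        ← mulVec_mulVec, dotProduct_mulVec, ← star_mulVec, key]
      push_cast
      simp [smul_eq_mul]
    rw [e]
    have h1 : ∀ i, ‖(B *ᵥ x) i‖ ^ 2 ≤ Fintype.card ι * ∑ j, ‖x j‖ ^ 2 := by
      intro i
      have h2 : ‖(B *ᵥ x) i‖ ≤ ∑ j, ‖x j‖ := by
        simp only [mulVec, dotProduct]
        refine (norm_sum_le _ _).trans (Finset.sum_le_sum fun j _ => ?_)
        rw [norm_mul]
        exact mul_le_of_le_one_left (norm_nonneg _) (hB i j)
      calc ‖(B *ᵥ x) i‖ ^ 2 ≤ (∑ j, ‖x j‖) ^ 2 := by gcongr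
        _ ≤ _ := by simpa using sq_sum_le_card_mul_sum_sq (s := Finset.univ) (f := fun j => ‖x j‖)
    have h3 : ∑ i, ‖(B *ᵥ x) i‖ ^ 2 ≤ Fintype.card ι * (Fintype.card ι * ∑ j, ‖x j‖ ^ 2) := by
      refine (Finset.sum_le_sum fun i _ => h1 i).trans ?_
      simp
    have h4 : 0 ≤ ∑ i, ‖x i‖ ^ 2 := by positivity
    have : (0 : ℝ) ≤ (Fintype.card ι ^ 2 + 1) * ∑ i, ‖x i‖ ^ 2 - ∑ i, ‖(B *ᵥ x) i‖ ^ 2 := by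
      nlinarith
    exact_mod_cast this

theorem Dg_mul_le' {ρ : ℝ} (hρ : 0 ≤ ρ) (B : Matrix ι ι ℂ) (A : Matrix ι κ ℂ)
    (hB : ∀ i j, ‖B i j‖ ≤ 1) :
    Dg ρ (B * A) ≤ (Fintype.card ι ^ 2 + 1 : ℝ) ^ Fintype.card κ * Dg ρ A :=
  Dg_mul_le hρ (by nlinarith [sq_nonneg (Fintype.card ι : ℝ)]) B A (psd_of_entries B hB)

theorem Dg_mul_mul_le {ρ : ℝ} (hρ : 0 ≤ ρ) (B : Matrix ι ι ℂ) (A : Matrix ι κ ℂ)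
    (C : Matrix κ κ ℂ) (hB : ∀ i j, ‖B i j‖ ≤ 1) (hC : ∀ i j, ‖C i j‖ ≤ 1) :
    Dg ρ (B * A * C) ≤ (Fintype.card ι ^ 2 + 1 : ℝ) ^ Fintype.card κ *
      (Fintype.card κ ^ 2 + 1 : ℝ) ^ Fintype.card ι * Dg ρ A := by
  rw [mul_assoc, Matrix.mul_assoc]
  refine (Dg_mul_le' hρ B (A * C) hB).trans ?_
  gcongr
  rw [← Dg_conjTranspose, ← Dg_conjTranspose ρ A, conjTranspose_mul]
  apply Dg_mul_le' hρ
  intro i j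
  simpa using hC j i

theorem Dg_reindex {ι' κ' : Type*} [Fintype ι'] [Fintype κ'] [DecidableEq ι']
    (e : ι ≃ ι') (f : κ ≃ κ') (ρ : ℝ) (A : Matrix ι κ ℂ) :
    Dg ρ (A.submatrix e.symm f.symm) = Dg ρ A := by
  unfold Dg
  rw [conjTranspose_submatrix, submatrix_mul_equiv]
  have : (1 : Matrix ι' ι' ℂ) = (1 : Matrix ι ι ℂ).submatrix e.symm e.symm := by simp
  have h2 : (1 : Matrix ι ι ℂ).submatrix e.symm e.symm +
      (ρ : ℂ) • (A * Aᴴ).submatrix e.symm e.symm =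
      (1 + (ρ : ℂ) • (A * Aᴴ)).submatrix e.symm e.symm := by
    rfl
  rw [this, h2, det_submatrix_equiv_self]

theorem Dg_blockDiag (ρ : ℝ) (p : ℂ) (S : Matrix ι κ ℂ) :
    Dg ρ (fromBlocks (of fun (_ _ : Unit) => p) 0 0 S) = (1 + ρ * ‖p‖ ^ 2) * Dg ρ S := by
  unfold Dg
  rw [fromBlocks_conjTranspose, fromBlocks_multiply, ← fromBlocks_one, fromBlocks_smul,
    fromBlocks_add]
  simp only [conjTranspose_zero, Matrix.mul_zero, Matrix.zero_mul, add_zero, zero_add, smul_zero]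
  rw [det_fromBlocks_zero₂₁]
  have : (1 + (ρ : ℂ) • ((of fun (_ _ : Unit) => p) * (of fun (_ _ : Unit) => p)ᴴ)).det
      = ((1 + ρ * ‖p‖ ^ 2 : ℝ) : ℂ) := by
    rw [det_unique]
    simp [Matrix.mul_apply, Complex.mul_conj']
  rw [this, Complex.re_ofReal_mul]

/-- the constant -/
noncomputable def Kc (n m : ℕ) : ℝ :=
  (((n + 1 : ℕ) : ℝ) ^ 2 + 1) ^ (m + 1) * (((m + 1 : ℕ) : ℝ) ^ 2 + 1) ^ (n + 1)

theorem Kc_pos (n m : ℕ) : 0 < Kc n m := by unfold Kc; positivity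

theorem Dg_block_bounds {n m : ℕ} {ρ : ℝ} (hρ : 0 ≤ ρ) (p : ℂ) (hp : p ≠ 0) (u : Fin m → ℂ)
    (v : Fin n → ℂ) (W : Matrix (Fin n) (Fin m) ℂ) (hu : ∀ j, ‖u j‖ ≤ ‖p‖)
    (hv : ∀ i, ‖v i‖ ≤ ‖p‖) :
    let H : Matrix (Unit ⊕ Fin n) (Unit ⊕ Fin m) ℂ :=
      fromBlocks (of fun _ _ => p) (of fun _ j => u j) (of fun i _ => v i) W
    let S : Matrix (Fin n) (Fin m) ℂ := of fun i j => W i j - v i * u j / p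
    Dg ρ H ≤ Kc n m * ((1 + ρ * ‖p‖ ^ 2) * Dg ρ S) ∧
    (1 + ρ * ‖p‖ ^ 2) * Dg ρ S ≤ Kc n m * Dg ρ H := by
  intro H S
  have hcn : Fintype.card (Unit ⊕ Fin n) = n + 1 := by simp [add_comm]
  have hcm : Fintype.card (Unit ⊕ Fin m) = m + 1 := by simp [add_comm]
  have hKc : Kc n m = ((Fintype.card (Unit ⊕ Fin n) : ℝ) ^ 2 + 1) ^ Fintype.card (Unit ⊕ Fin m) *
      ((Fintype.card (Unit ⊕ Fin m) : ℝ) ^ 2 + 1) ^ Fintype.card (Unit ⊕ Fin n) := by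
    rw [hcn, hcm]; rfl
  have hp' : 0 < ‖p‖ := norm_pos_iff.2 hp
  have bl : ∀ (a : Fin n → ℂ), (∀ i, ‖a i‖ ≤ 1) → ∀ i j,
      ‖(fromBlocks 1 0 (of fun i _ => a i) 1 : Matrix (Unit ⊕ Fin n) (Unit ⊕ Fin n) ℂ) i j‖ ≤ 1 := by
    intro a ha i j
    rcases i with i | i <;> rcases j with j | j <;> simp [Matrix.one_apply, ha]
    split_ifs <;> simp
  have bu : ∀ (a : Fin m → ℂ), (∀ i, ‖a i‖ ≤ 1) → ∀ i j,
      ‖(fromBlocks 1 (of fun _ i => a i) 0 1 : Matrix (Unit ⊕ Fin m) (Unit ⊕ Fin m) ℂ) i j‖ ≤ 1 := by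
    intro a ha i j
    rcases i with i | i <;> rcases j with j | j <;> simp [Matrix.one_apply, ha]
    split_ifs <;> simp
  have hu' : ∀ j, ‖u j / p‖ ≤ 1 := fun j => by
    rw [norm_div, div_le_one hp']; exact hu j
  have hv' : ∀ j, ‖v j / p‖ ≤ 1 := fun j => by
    rw [norm_div, div_le_one hp']; exact hv j
  have hu'' : ∀ j, ‖-(u j / p)‖ ≤ 1 := fun j => by rw [norm_neg]; exact hu' j
  have hv'' : ∀ j, ‖-(v j / p)‖ ≤ 1 := fun j => by rw [norm_neg]; exact hv' j
  rw [← Dg_blockDiag, hKc]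
  constructor
  · have e : H = (fromBlocks 1 0 (of fun i _ => v i / p) 1 : Matrix (Unit ⊕ Fin n) (Unit ⊕ Fin n) ℂ) *
        fromBlocks (of fun (_ _ : Unit) => p) 0 0 S *
        (fromBlocks 1 (of fun _ i => u i / p) 0 1 : Matrix (Unit ⊕ Fin m) (Unit ⊕ Fin m) ℂ) := by
      rw [fromBlocks_multiply, fromBlocks_multiply]
      simp only [H]
      congr 1 <;> ext i j <;> simp [Matrix.mul_apply, S] <;> field_simp
      ring
    rw [e]
    exact Dg_mul_mul_le hρ _ _ _ (bl _ hv') (bu _ hu')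
  · have e : fromBlocks (of fun (_ _ : Unit) => p) 0 0 S =
        (fromBlocks 1 0 (of fun i _ => -(v i / p)) 1 : Matrix (Unit ⊕ Fin n) (Unit ⊕ Fin n) ℂ) *
        H * (fromBlocks 1 (of fun _ i => -(u i / p)) 0 1 : Matrix (Unit ⊕ Fin m) (Unit ⊕ Fin m) ℂ) := by
      simp only [H]
      rw [fromBlocks_multiply, fromBlocks_multiply]
      congr 1 <;> ext i j <;> simp [Matrix.mul_apply, S] <;> field_simp <;> ring
    rw [e]
    exact Dg_mul_mul_le hρ _ _ _ (bl _ hv'') (bu _ hu'')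

end MatrixPart


section MeasurePart
open Matrix

/-- Assemble a matrix from pivot, pivot row, pivot column and the rest. -/
noncomputable def asm {n m : ℕ} (i0 : Fin (n + 1)) (j0 : Fin (m + 1)) (p : ℂ) (u : Fin m → ℂ)
    (v : Fin n → ℂ) (W : Fin n → Fin m → ℂ) : Fin (n + 1) → Fin (m + 1) → ℂ :=
  Fin.insertNth (α := fun _ => Fin (m + 1) → ℂ) i0
    (Fin.insertNth (α := fun _ => ℂ) j0 p u)
    (fun i => Fin.insertNth (α := fun _ => ℂ) j0 (v i) (W i))

theorem asm_pp {n m : ℕ} (i0 : Fin (n + 1)) (j0 : Fin (m + 1)) (p : ℂ) (u : Fin m → ℂ)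
    (v : Fin n → ℂ) (W : Fin n → Fin m → ℂ) : asm i0 j0 p u v W i0 j0 = p := by
  simp [asm]

theorem asm_pu {n m : ℕ} (i0 : Fin (n + 1)) (j0 : Fin (m + 1)) (p : ℂ) (u : Fin m → ℂ)
    (v : Fin n → ℂ) (W : Fin n → Fin m → ℂ) (j) :
    asm i0 j0 p u v W i0 (j0.succAbove j) = u j := by
  simp [asm]

theorem asm_pv {n m : ℕ} (i0 : Fin (n + 1)) (j0 : Fin (m + 1)) (p : ℂ) (u : Fin m → ℂ)
    (v : Fin n → ℂ) (W : Fin n → Fin m → ℂ) (i) :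
    asm i0 j0 p u v W (i0.succAbove i) j0 = v i := by
  simp [asm]

theorem asm_pW {n m : ℕ} (i0 : Fin (n + 1)) (j0 : Fin (m + 1)) (p : ℂ) (u : Fin m → ℂ)
    (v : Fin n → ℂ) (W : Fin n → Fin m → ℂ) (i j) :
    asm i0 j0 p u v W (i0.succAbove i) (j0.succAbove j) = W i j := by
  simp [asm]

theorem Dg_asm {n m : ℕ} (i0 : Fin (n + 1)) (j0 : Fin (m + 1)) (p : ℂ) (u : Fin m → ℂ)
    (v : Fin n → ℂ) (W : Fin n → Fin m → ℂ) (ρ : ℝ) :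
    Dg ρ (Matrix.of (asm i0 j0 p u v W)) =
    Dg ρ (fromBlocks (of fun (_ _ : Unit) => p) (of fun _ j => u j) (of fun i _ => v i) (of W)) := by
  let e : ∀ {k : ℕ} (_ : Fin (k + 1)), Unit ⊕ Fin k ≃ Fin (k + 1) := fun {k} i =>
    ((Equiv.sumComm _ _).trans (Equiv.optionEquivSumPUnit _).symm).trans (finSuccEquiv' i).symm
  have e1 : ∀ {k : ℕ} (i : Fin (k + 1)), (e i).symm i = Sum.inl () := by
    intro k i
    simp [e]
  have e2 : ∀ {k : ℕ} (i : Fin (k + 1)) (j), (e i).symm (i.succAbove j) = Sum.inr j := by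
    intro k i j
    simp [e]
  rw [← Dg_reindex (e i0) (e j0)]
  congr 1
  ext i j
  rcases Fin.eq_self_or_eq_succAbove i0 i with rfl | ⟨i, rfl⟩ <;>
  rcases Fin.eq_self_or_eq_succAbove j0 j with rfl | ⟨j, rfl⟩
  · simp [e1, asm_pp]
  · simp [e1, e2, asm_pu]
  · simp [e1, e2, asm_pv]
  · simp [e2, asm_pW]

theorem measurable_asm {n m : ℕ} (i0 : Fin (n + 1)) (j0 : Fin (m + 1)) :
    Measurable (fun x : (ℂ × (Fin m → ℂ)) × (Fin n → ℂ) × (Fin n → Fin m → ℂ) =>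
      asm i0 j0 x.1.1 x.1.2 x.2.1 x.2.2) := by
  refine measurable_pi_iff.2 fun i => measurable_pi_iff.2 fun j => ?_
  rcases Fin.eq_self_or_eq_succAbove i0 i with rfl | ⟨i, rfl⟩ <;>
  rcases Fin.eq_self_or_eq_succAbove j0 j with rfl | ⟨j, rfl⟩
  · simp only [asm_pp]; fun_prop
  · simp only [asm_pu]; fun_prop
  · simp only [asm_pv]; fun_prop
  · simp only [asm_pW]; fun_prop

theorem mp_asm {n m : ℕ} (i0 : Fin (n + 1)) (j0 : Fin (m + 1)) :
    MeasurePreserving (fun x : (ℂ × (Fin m → ℂ)) × (Fin n → ℂ) × (Fin n → Fin m → ℂ) =>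
      asm i0 j0 x.1.1 x.1.2 x.2.1 x.2.2) volume volume := by
  have h1 := (volume_preserving_piFinSuccAbove (fun _ : Fin (m + 1) => ℂ) j0).symm
  have h2 : MeasurePreserving (fun (y : Fin n → (ℂ × (Fin m → ℂ))) (i : Fin n) =>
      (MeasurableEquiv.piFinSuccAbove (fun _ : Fin (m + 1) => ℂ) j0).symm (y i)) volume volume :=
    volume_preserving_pi (fun _ => h1)
  have h3 := (volume_measurePreserving_arrowProdEquivProdArrow ℂ (Fin m → ℂ) (Fin n)).symm
  have h4 := h1.prod (h2.comp h3)
  have h5 := (volume_preserving_piFinSuccAbove (fun _ : Fin (n + 1) => (Fin (m + 1) → ℂ)) i0).symm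
  exact h5.comp h4

theorem lint_shear {n m : ℕ} (i0 : Fin (n + 1)) (j0 : Fin (m + 1))
    (F : (Fin (n + 1) → Fin (m + 1) → ℂ) → ENNReal) (hF : Measurable F) :
    ∫⁻ H, F H = ∫⁻ p : ℂ, ∫⁻ u : Fin m → ℂ, ∫⁻ v : Fin n → ℂ, ∫⁻ S : Fin n → Fin m → ℂ,
      F (asm i0 j0 p u v (fun i j => S i j + v i * u j / p)) := by
  rw [← (mp_asm i0 j0).lintegral_comp hF]
  have hm : Measurable (fun x : (ℂ × (Fin m → ℂ)) × (Fin n → ℂ) × (Fin n → Fin m → ℂ) =>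
      F (asm i0 j0 x.1.1 x.1.2 x.2.1 x.2.2)) := hF.comp (measurable_asm i0 j0)
  rw [Measure.volume_eq_prod, lintegral_prod _ hm.aemeasurable]
  rw [Measure.volume_eq_prod, lintegral_prod _ (by exact (hm.lintegral_prod_right').aemeasurable)]
  refine lintegral_congr fun p => lintegral_congr fun u => ?_
  rw [Measure.volume_eq_prod,
    lintegral_prod _ (by exact (hm.comp measurable_prodMk_left).aemeasurable)]
  refine lintegral_congr fun v => ?_
  exact (lintegral_add_right_eq_self
    (fun W : Fin n → Fin m → ℂ => F (asm i0 j0 p u v W)) (fun i j => v i * u j / p)).symm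

theorem continuous_Dg {n m : ℕ} (ρ : ℝ) :
    Continuous (fun H : Fin n → Fin m → ℂ => Dg ρ (Matrix.of H)) := by
  unfold Dg
  apply Complex.continuous_re.comp
  apply Continuous.matrix_det
  apply Continuous.add continuous_const
  refine Continuous.const_smul (g := fun H : Fin n → Fin m → ℂ => Matrix.of H * (Matrix.of H)ᴴ) ?_ (ρ : ℂ)
  have h : Continuous (fun H : Fin n → Fin m → ℂ => (Matrix.of H : Matrix (Fin n) (Fin m) ℂ)) :=
    continuous_id
  exact h.matrix_mul h.matrix_conjTranspose

theorem vol_box (k : ℕ) (r : ℝ) (hr : 0 ≤ r) :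
    volume {u : Fin k → ℂ | ∀ j, ‖u j‖ ≤ r} = ENNReal.ofReal ((r ^ 2 * Real.pi) ^ k) := by
  have : {u : Fin k → ℂ | ∀ j, ‖u j‖ ≤ r} = Set.univ.pi fun _ => Metric.closedBall (0 : ℂ) r := by
    ext u; simp
  rw [this, volume_pi_pi]
  simp only [Complex.volume_closedBall, Finset.prod_const, Finset.card_univ, Fintype.card_fin]
  rw [ENNReal.ofReal_pow (by positivity), ENNReal.ofReal_mul (by positivity),
    ENNReal.ofReal_pow hr, ← NNReal.coe_real_pi, ENNReal.ofReal_coe_nnreal]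

theorem meas_box (k : ℕ) (r : ℝ) : MeasurableSet {u : Fin k → ℂ | ∀ j, ‖u j‖ ≤ r} := by
  have : {u : Fin k → ℂ | ∀ j, ‖u j‖ ≤ r} = ⋂ j, {u | ‖u j‖ ≤ r} := by ext; simp
  rw [this]
  exact MeasurableSet.iInter fun j => measurableSet_le (by fun_prop) measurable_const

/-- upper step -/
theorem upper_step {n m : ℕ} (i0 : Fin (n + 1)) (j0 : Fin (m + 1))
    (F : (Fin (n + 1) → Fin (m + 1) → ℂ) → ENNReal) (hF : Measurable F)
    (G : ℂ → ENNReal) (hG : Measurable G) (K : (Fin n → Fin m → ℂ) → ENNReal) (hK : Measurable K)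
    (h : ∀ p u v S, p ≠ 0 → (∀ j, ‖u j‖ ≤ ‖p‖) → (∀ i, ‖v i‖ ≤ ‖p‖) →
      (∀ i j, ‖S i j + v i * u j / p‖ ≤ ‖p‖) →
      F (asm i0 j0 p u v (fun i j => S i j + v i * u j / p)) ≤ G p * K S) :
    ∫⁻ H, {H | ∀ i j, ‖H i j‖ ≤ ‖H i0 j0‖}.indicator F H ≤
      (∫⁻ p, G p * ENNReal.ofReal ((‖p‖ ^ 2 * Real.pi) ^ (n + m))) * ∫⁻ S, K S := by
  have hset : MeasurableSet {H : Fin (n + 1) → Fin (m + 1) → ℂ | ∀ i j, ‖H i j‖ ≤ ‖H i0 j0‖} := by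
    have : {H : Fin (n + 1) → Fin (m + 1) → ℂ | ∀ i j, ‖H i j‖ ≤ ‖H i0 j0‖} =
      ⋂ i, ⋂ j, {H | ‖H i j‖ ≤ ‖H i0 j0‖} := by ext; simp
    rw [this]
    exact MeasurableSet.iInter fun i => MeasurableSet.iInter fun j =>
      measurableSet_le (by fun_prop) (by fun_prop)
  rw [lint_shear i0 j0 _ (hF.indicator hset)]
  have hb : ∀ᵐ p : ℂ, p ≠ 0 := by
    simp [ae_iff]
  rw [← lintegral_mul_const _ (by fun_prop)]
  refine lintegral_mono_ae (hb.mono ?_)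
  intro p hp
  have hle : ∀ (u : Fin m → ℂ) (v : Fin n → ℂ) (S : Fin n → Fin m → ℂ),
      {H : Fin (n + 1) → Fin (m + 1) → ℂ | ∀ i j, ‖H i j‖ ≤ ‖H i0 j0‖}.indicator F
        (asm i0 j0 p u v (fun i j => S i j + v i * u j / p)) ≤
      {u : Fin m → ℂ | ∀ j, ‖u j‖ ≤ ‖p‖}.indicator 1 u *
        ({v : Fin n → ℂ | ∀ j, ‖v j‖ ≤ ‖p‖}.indicator 1 v * (G p * K S)) := by
    intro u v S
    refine Set.indicator_apply_le' ?_ (fun _ => by simp)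
    intro hH
    simp only [Set.mem_ofPred_eq, asm_pp] at hH
    have hu : ∀ j, ‖u j‖ ≤ ‖p‖ := fun j => by simpa [asm_pu] using hH i0 (j0.succAbove j)
    have hv : ∀ j, ‖v j‖ ≤ ‖p‖ := fun j => by simpa [asm_pv] using hH (i0.succAbove j) j0
    have hS : ∀ i j, ‖S i j + v i * u j / p‖ ≤ ‖p‖ := fun i j => by
      simpa [asm_pW] using hH (i0.succAbove i) (j0.succAbove j)
    rw [Set.indicator_of_mem (by exact hu), Set.indicator_of_mem (by exact hv)]
    simpa using h p u v S hp hu hv hS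
  calc _ ≤ ∫⁻ u : Fin m → ℂ, ∫⁻ v : Fin n → ℂ, ∫⁻ S : Fin n → Fin m → ℂ,
        {u : Fin m → ℂ | ∀ j, ‖u j‖ ≤ ‖p‖}.indicator 1 u *
        ({v : Fin n → ℂ | ∀ j, ‖v j‖ ≤ ‖p‖}.indicator 1 v * (G p * K S)) :=
        lintegral_mono fun u => lintegral_mono fun v => lintegral_mono fun S => hle u v S
    _ = G p * ENNReal.ofReal ((‖p‖ ^ 2 * Real.pi) ^ (n + m)) * ∫⁻ S, K S := by
      have m1 : Measurable ({v : Fin n → ℂ | ∀ j, ‖v j‖ ≤ ‖p‖}.indicator (1 : (Fin n → ℂ) → ENNReal)) :=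
        measurable_one.indicator (meas_box _ _)
      have m2 : Measurable ({v : Fin m → ℂ | ∀ j, ‖v j‖ ≤ ‖p‖}.indicator (1 : (Fin m → ℂ) → ENNReal)) :=
        measurable_one.indicator (meas_box _ _)
      simp_rw [lintegral_const_mul _ ((hK.const_mul _).const_mul _),
        lintegral_const_mul _ (hK.const_mul _), lintegral_const_mul _ hK]
      simp_rw [lintegral_const_mul _ (m1.mul_const _), lintegral_mul_const _ m1,
        lintegral_mul_const _ m2]
      rw [lintegral_indicator_one (meas_box _ _), lintegral_indicator_one (meas_box _ _),
        vol_box _ _ (norm_nonneg _), vol_box _ _ (norm_nonneg _), pow_add,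
        ENNReal.ofReal_mul (by positivity)]
      ring

theorem lower_step {n m : ℕ} (i0 : Fin (n + 1)) (j0 : Fin (m + 1))
    (R' : Set (Fin (n + 1) → Fin (m + 1) → ℂ)) (hR' : MeasurableSet R')
    (A : Set ℂ) (hA : MeasurableSet A) (t : ℝ) (ht : 0 ≤ t)
    (R : Set (Fin n → Fin m → ℂ)) (hR : MeasurableSet R)
    (h : ∀ p ∈ A, ∀ u v, ∀ S ∈ R, (∀ j, ‖u j‖ ≤ t) → (∀ i, ‖v i‖ ≤ t) →
      asm i0 j0 p u v (fun i j => S i j + v i * u j / p) ∈ R') :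
    volume A * ENNReal.ofReal ((t ^ 2 * Real.pi) ^ (n + m)) * volume R ≤ volume R' := by
  rw [← lintegral_indicator_one hR', lint_shear i0 j0 _ (measurable_one.indicator hR')]
  have m1 : Measurable ({v : Fin n → ℂ | ∀ j, ‖v j‖ ≤ t}.indicator (1 : (Fin n → ℂ) → ENNReal)) :=
    measurable_one.indicator (meas_box _ _)
  have m2 : Measurable ({v : Fin m → ℂ | ∀ j, ‖v j‖ ≤ t}.indicator (1 : (Fin m → ℂ) → ENNReal)) :=
    measurable_one.indicator (meas_box _ _)
  have m3 : Measurable (R.indicator (1 : (Fin n → Fin m → ℂ) → ENNReal)) := measurable_one.indicator hR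
  have m4 : Measurable (A.indicator (1 : ℂ → ENNReal)) := measurable_one.indicator hA
  calc
    _ = ∫⁻ p : ℂ, ∫⁻ u : Fin m → ℂ, ∫⁻ v : Fin n → ℂ, ∫⁻ S : Fin n → Fin m → ℂ,
        A.indicator 1 p * ({u : Fin m → ℂ | ∀ j, ‖u j‖ ≤ t}.indicator 1 u *
        ({v : Fin n → ℂ | ∀ j, ‖v j‖ ≤ t}.indicator 1 v * R.indicator 1 S)) := by
      simp_rw [lintegral_const_mul _ ((m3.const_mul _).const_mul _),
        lintegral_const_mul _ (m3.const_mul _), lintegral_const_mul _ m3]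
      simp_rw [lintegral_const_mul _ ((m1.mul_const _).const_mul _),
        lintegral_const_mul _ (m1.mul_const _), lintegral_mul_const _ m1]
      simp_rw [lintegral_const_mul _ (m2.mul_const _), lintegral_mul_const _ m2,
        lintegral_mul_const _ m4]
      rw [lintegral_indicator_one (meas_box _ _), lintegral_indicator_one (meas_box _ _),
        lintegral_indicator_one hA, lintegral_indicator_one hR,
        vol_box _ _ ht, vol_box _ _ ht, pow_add,
        ENNReal.ofReal_mul (by positivity)]
      ring
    _ ≤ _ := by
      refine lintegral_mono fun p => lintegral_mono fun u => lintegral_mono fun v =>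
        lintegral_mono fun S => ?_
      by_cases hp : p ∈ A
      · by_cases hu : ∀ j, ‖u j‖ ≤ t
        · by_cases hv : ∀ j, ‖v j‖ ≤ t
          · by_cases hS : S ∈ R
            · rw [Set.indicator_of_mem (s := R') (h p hp u v S hS hu hv)]
              rw [Set.indicator_of_mem hp, Set.indicator_of_mem hS, Set.indicator_of_mem (by exact hu),
                Set.indicator_of_mem (by exact hv)]
              simp
            · simp [hS]
          · rw [Set.indicator_of_notMem (s := {v : Fin n → ℂ | ∀ j, ‖v j‖ ≤ t}) (by exact hv)]
            simp
        · rw [Set.indicator_of_notMem (s := {v : Fin m → ℂ | ∀ j, ‖v j‖ ≤ t}) (by exact hu)]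
          simp
      · simp [hp]

end MeasurePart


section InductionPart
open Matrix

theorem vol_univ_zero (k : ℕ) : volume (Set.univ : Set (Fin k → Fin 0 → ℂ)) = 1 := by
  rw [← Set.pi_univ, volume_pi_pi]
  apply Finset.prod_eq_one
  intro i _
  rw [← Set.pi_univ, volume_pi_pi]
  simp

theorem gamma_fin {q b : ℝ} (hq : -2 < q) (hb : 0 < b) :
    ∃ C : ℝ, 0 ≤ C ∧ ∫⁻ p : ℂ, ENNReal.ofReal (‖p‖ ^ q * Real.exp (-b * ‖p‖ ^ (2 : ℝ))) =
      ENNReal.ofReal C := by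
  have h := Complex.integral_rpow_mul_exp_neg_mul_rpow (p := 2) (q := q) (b := b) (by norm_num) hq hb
  have hne : ∫ x : ℂ, ‖x‖ ^ q * Real.exp (-b * ‖x‖ ^ (2 : ℝ)) ≠ 0 := by
    rw [h]
    have : 0 < Real.Gamma ((q + 2) / 2) := Real.Gamma_pos_of_pos (by linarith)
    positivity
  have hi := Integrable.of_integral_ne_zero hne
  refine ⟨_, ?_, (ofReal_integral_eq_lintegral_ofReal hi ?_).symm⟩
  · exact integral_nonneg fun x => by positivity
  · exact Filter.Eventually.of_forall fun x => by simp only [Pi.zero_apply]; positivity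

/-- the integrand for the upper bound -/
noncomputable def fU (n m : ℕ) (ρ s b : ℝ) (H : Fin n → Fin m → ℂ) : ENNReal :=
  ENNReal.ofReal (Dg ρ (Matrix.of H) ^ (-s) * Real.exp (-b * ∑ i, ∑ j, ‖H i j‖ ^ 2))

theorem measurable_fU (n m : ℕ) (ρ s b : ℝ) : Measurable (fU n m ρ s b) := by
  unfold fU
  have := (continuous_Dg (n := n) (m := m) ρ).measurable
  fun_prop

theorem fU_le_one {n m : ℕ} {ρ s b : ℝ} (hρ : 0 ≤ ρ) (hs : 0 ≤ s) (hb : 0 ≤ b)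
    (H : Fin n → Fin m → ℂ) : fU n m ρ s b H ≤ 1 := by
  unfold fU
  rw [ENNReal.ofReal_le_one]
  have h1 : Dg ρ (Matrix.of H) ^ (-s) ≤ 1 :=
    Real.rpow_le_one_of_one_le_of_nonpos (one_le_Dg hρ _) (by linarith)
  have h2 : Real.exp (-b * ∑ i, ∑ j, ‖H i j‖ ^ 2) ≤ 1 := by
    rw [Real.exp_le_one_iff]
    have : 0 ≤ ∑ i, ∑ j, ‖H i j‖ ^ 2 := by positivity
    nlinarith
  exact mul_le_one₀ h1 (Real.exp_pos _).le h2

theorem fU_pointwise {n m : ℕ} (i0 : Fin (n + 1)) (j0 : Fin (m + 1)) {ρ s b t : ℝ} (hρ : 0 < ρ)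
    (hs : 0 ≤ s) (hb : 0 < b) (ht : 0 ≤ t) (hts : t ≤ s) (p : ℂ) (u : Fin m → ℂ) (v : Fin n → ℂ)
    (S : Fin n → Fin m → ℂ) (hp : p ≠ 0) (hu : ∀ j, ‖u j‖ ≤ ‖p‖) (hv : ∀ i, ‖v i‖ ≤ ‖p‖)
    (hS : ∀ i j, ‖S i j + v i * u j / p‖ ≤ ‖p‖) :
    fU (n + 1) (m + 1) ρ s b (asm i0 j0 p u v (fun i j => S i j + v i * u j / p)) ≤
    ENNReal.ofReal (Kc n m ^ s * ρ ^ (-t) * (‖p‖ ^ (-2 * t) * Real.exp (-(b / 2) * ‖p‖ ^ (2 : ℝ)))) *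
      fU n m ρ s (b / (8 * (n * m + 1))) S := by
  have hp' : 0 < ‖p‖ := norm_pos_iff.2 hp
  unfold fU
  rw [← ENNReal.ofReal_mul (by have := Kc_pos n m; positivity)]
  apply ENNReal.ofReal_le_ofReal
  have hD : (1 + ρ * ‖p‖ ^ 2) * Dg ρ (Matrix.of S) ≤ Kc n m *
      Dg ρ (Matrix.of (asm i0 j0 p u v (fun i j => S i j + v i * u j / p))) := by
    have h := (Dg_block_bounds hρ.le p hp u v (Matrix.of fun i j => S i j + v i * u j / p) hu hv).2
    rw [Dg_asm]
    simpa using h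
  set D := Dg ρ (Matrix.of (asm i0 j0 p u v (fun i j => S i j + v i * u j / p))) with hDdef
  set D' := Dg ρ (Matrix.of S)
  have hD1 : 1 ≤ D := one_le_Dg hρ.le _
  have hD1' : 1 ≤ D' := one_le_Dg hρ.le _
  have hK := Kc_pos n m
  have hx : 0 < ρ * ‖p‖ ^ 2 := by positivity
  have e1 : D ^ (-s) ≤ Kc n m ^ s * ((ρ * ‖p‖ ^ 2) ^ (-t) * D' ^ (-s)) := by
    have a1 : (Kc n m * D) ^ (-s) ≤ ((1 + ρ * ‖p‖ ^ 2) * D') ^ (-s) :=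
      Real.rpow_le_rpow_of_nonpos (by positivity) hD (by linarith)
    rw [Real.mul_rpow (by positivity) (by positivity), Real.mul_rpow (by positivity) (by positivity)] at a1
    have a2 : (1 + ρ * ‖p‖ ^ 2) ^ (-s) ≤ (ρ * ‖p‖ ^ 2) ^ (-t) :=
      calc (1 + ρ * ‖p‖ ^ 2) ^ (-s) ≤ (1 + ρ * ‖p‖ ^ 2) ^ (-t) :=
            Real.rpow_le_rpow_of_exponent_le (by linarith) (by linarith)
        _ ≤ _ := Real.rpow_le_rpow_of_nonpos hx (by linarith) (by linarith)
    have a3 : Kc n m ^ s * Kc n m ^ (-s) = 1 := by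
      rw [← Real.rpow_add hK]; simp
    calc D ^ (-s) = Kc n m ^ s * (Kc n m ^ (-s) * D ^ (-s)) := by rw [← mul_assoc, a3, one_mul]
      _ ≤ Kc n m ^ s * ((1 + ρ * ‖p‖ ^ 2) ^ (-s) * D' ^ (-s)) := by gcongr
      _ ≤ _ := by gcongr
  have e2 : (ρ * ‖p‖ ^ 2) ^ (-t) = ρ ^ (-t) * ‖p‖ ^ (-2 * t) := by
    rw [Real.mul_rpow hρ.le (by positivity), ← Real.rpow_natCast, ← Real.rpow_mul (norm_nonneg _)]
    congr 2
    push_cast; ring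
  have e3 : ‖p‖ ^ 2 ≤ ∑ i, ∑ j, ‖asm i0 j0 p u v (fun i j => S i j + v i * u j / p) i j‖ ^ 2 := by
    calc ‖p‖ ^ 2 = ‖asm i0 j0 p u v (fun i j => S i j + v i * u j / p) i0 j0‖ ^ 2 := by rw [asm_pp]
      _ ≤ ∑ j, ‖asm i0 j0 p u v (fun i j => S i j + v i * u j / p) i0 j‖ ^ 2 :=
        Finset.single_le_sum (f := fun j => ‖asm i0 j0 p u v (fun i j => S i j + v i * u j / p) i0 j‖ ^ 2)
          (fun _ _ => by positivity) (Finset.mem_univ j0)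
      _ ≤ _ := Finset.single_le_sum
          (f := fun i => ∑ j, ‖asm i0 j0 p u v (fun i j => S i j + v i * u j / p) i j‖ ^ 2)
          (fun _ _ => by positivity) (Finset.mem_univ i0)
  have e4 : ∀ i j, ‖S i j‖ ^ 2 ≤ 4 * ‖p‖ ^ 2 := by
    intro i j
    have h1 : ‖v i * u j / p‖ ≤ ‖p‖ := by
      rw [norm_div, norm_mul, div_le_iff₀ hp']
      exact mul_le_mul (hv i) (hu j) (norm_nonneg _) (norm_nonneg _)
    have h2 : ‖S i j‖ ≤ 2 * ‖p‖ := by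
      calc ‖S i j‖ = ‖(S i j + v i * u j / p) - v i * u j / p‖ := by rw [add_sub_cancel_right]
        _ ≤ ‖S i j + v i * u j / p‖ + ‖v i * u j / p‖ := norm_sub_le _ _
        _ ≤ _ := by linarith [hS i j]
    calc ‖S i j‖ ^ 2 ≤ (2 * ‖p‖) ^ 2 := by gcongr
      _ = _ := by ring
  have e5 : ∑ i, ∑ j, ‖S i j‖ ^ 2 ≤ 4 * (n * m + 1) * ‖p‖ ^ 2 := by
    calc ∑ i, ∑ j, ‖S i j‖ ^ 2 ≤ ∑ i : Fin n, ∑ j : Fin m, 4 * ‖p‖ ^ 2 :=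
          Finset.sum_le_sum fun i _ => Finset.sum_le_sum fun j _ => e4 i j
      _ = 4 * (n * m) * ‖p‖ ^ 2 := by simp; ring
      _ ≤ _ := by gcongr; linarith
  have e6 : Real.exp (-b * ∑ i, ∑ j, ‖asm i0 j0 p u v (fun i j => S i j + v i * u j / p) i j‖ ^ 2) ≤
      Real.exp (-(b / 2) * ‖p‖ ^ (2 : ℝ)) * Real.exp (-(b / (8 * (n * m + 1))) * ∑ i, ∑ j, ‖S i j‖ ^ 2) := by
    rw [← Real.exp_add, Real.exp_le_exp, Real.rpow_two]
    have hN : (0 : ℝ) < n * m + 1 := by positivity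
    have h1 : (b / (8 * (n * m + 1))) * ∑ i, ∑ j, ‖S i j‖ ^ 2 ≤ b / 2 * ‖p‖ ^ 2 := by
      calc _ ≤ (b / (8 * (n * m + 1))) * (4 * (n * m + 1) * ‖p‖ ^ 2) := by gcongr
        _ = _ := by field_simp; ring
    nlinarith
  calc _ ≤ (Kc n m ^ s * ((ρ * ‖p‖ ^ 2) ^ (-t) * D' ^ (-s))) * (Real.exp (-(b / 2) * ‖p‖ ^ (2 : ℝ)) *
        Real.exp (-(b / (8 * (n * m + 1))) * ∑ i, ∑ j, ‖S i j‖ ^ 2)) := by gcongr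
    _ = _ := by rw [e2]; ring

theorem upper_main (n : ℕ) : ∀ (m : ℕ) (s b : ℝ) (τ : ℕ → ℝ), 0 ≤ s → 0 < b →
    (∀ i < min n m, 0 ≤ τ i ∧ τ i ≤ s ∧ τ i < (n : ℝ) + m - 2 * i - 1) →
    ∃ C : ℝ, 0 ≤ C ∧ ∀ ρ : ℝ, 0 < ρ →
      ∫⁻ H, fU n m ρ s b H ≤ ENNReal.ofReal (C * ρ ^ (-∑ i ∈ Finset.range (min n m), τ i)) := by
  induction n with
  | zero =>
    intro m s b τ hs hb _
    refine ⟨1, zero_le_one, fun ρ hρ => ?_⟩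
    calc ∫⁻ H, fU 0 m ρ s b H ≤ ∫⁻ H : Fin 0 → Fin m → ℂ, 1 :=
          lintegral_mono fun H => fU_le_one hρ.le hs hb.le H
      _ = 1 := by simp [volume_pi]
      _ ≤ _ := by simp
  | succ n ih =>
    intro m s b τ hs hb hτ
    cases m with
    | zero =>
      refine ⟨1, zero_le_one, fun ρ hρ => ?_⟩
      calc ∫⁻ H, fU (n + 1) 0 ρ s b H ≤ ∫⁻ H : Fin (n + 1) → Fin 0 → ℂ, 1 :=
            lintegral_mono fun H => fU_le_one hρ.le hs hb.le H
        _ = 1 := by rw [lintegral_one, vol_univ_zero]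
        _ ≤ _ := by simp
    | succ m =>
      obtain ⟨C1, hC1, h1⟩ := ih m s (b / (8 * (n * m + 1))) (fun i => τ (i + 1)) hs (by positivity)
        (by
          intro i hi
          have := hτ (i + 1) (by omega)
          refine ⟨this.1, this.2.1, ?_⟩
          have h := this.2.2
          push_cast at h
          linarith)
      have h0 := hτ 0 (by omega)
      obtain ⟨C2, hC2, h2⟩ := gamma_fin (q := 2 * (n + m) - 2 * τ 0) (b := b / 2)
        (by have := h0.2.2; push_cast at this; linarith) (by positivity)
      refine ⟨(n + 1) * (m + 1) * (Kc n m ^ s * Real.pi ^ (n + m) * C2 * C1),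
        by have := Kc_pos n m; positivity, fun ρ hρ => ?_⟩
      have hK := Kc_pos n m
      have step : ∀ i0 j0, ∫⁻ H, {H | ∀ i j, ‖H i j‖ ≤ ‖H i0 j0‖}.indicator
          (fU (n + 1) (m + 1) ρ s b) H ≤ ENNReal.ofReal ((Kc n m ^ s * Real.pi ^ (n + m) * C2 * C1) *
            ρ ^ (-∑ i ∈ Finset.range (min (n + 1) (m + 1)), τ i)) := by
        intro i0 j0
        refine (upper_step i0 j0 _ (measurable_fU _ _ _ _ _)
          (fun p => ENNReal.ofReal (Kc n m ^ s * ρ ^ (-τ 0) *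
            (‖p‖ ^ (-2 * τ 0) * Real.exp (-(b / 2) * ‖p‖ ^ (2 : ℝ))))) (by fun_prop)
          (fU n m ρ s (b / (8 * (n * m + 1)))) (measurable_fU _ _ _ _ _)
          (fun p u v S hp hu hv hS => fU_pointwise i0 j0 hρ hs hb h0.1 h0.2.1 p u v S hp hu hv hS)).trans ?_
        have e1 : ∫⁻ p : ℂ, ENNReal.ofReal (Kc n m ^ s * ρ ^ (-τ 0) *
            (‖p‖ ^ (-2 * τ 0) * Real.exp (-(b / 2) * ‖p‖ ^ (2 : ℝ)))) *
            ENNReal.ofReal ((‖p‖ ^ 2 * Real.pi) ^ (n + m)) ≤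
            ENNReal.ofReal (Kc n m ^ s * ρ ^ (-τ 0) * Real.pi ^ (n + m) * C2) := by
          rw [ENNReal.ofReal_mul (by positivity), ← h2, ← lintegral_const_mul _ (by fun_prop)]
          have hb : ∀ᵐ p : ℂ, p ≠ 0 := by simp [ae_iff]
          refine lintegral_mono_ae (hb.mono fun p hp => ?_)
          have hp' : 0 < ‖p‖ := norm_pos_iff.2 hp
          rw [← ENNReal.ofReal_mul (by positivity), ← ENNReal.ofReal_mul (by positivity)]
          apply le_of_eq
          congr 1
          have : ‖p‖ ^ (2 * ((n : ℝ) + m) - 2 * τ 0) = ‖p‖ ^ (-2 * τ 0) * (‖p‖ ^ 2) ^ (n + m) := by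
            rw [← pow_mul, ← Real.rpow_natCast, ← Real.rpow_add hp']
            congr 1
            push_cast; ring
          rw [this, mul_pow]; ring
        refine (mul_le_mul' e1 (h1 ρ hρ)).trans (le_of_eq ?_)
        rw [← ENNReal.ofReal_mul (by positivity)]
        congr 1
        have hmin : min (n + 1) (m + 1) = min n m + 1 := by omega
        rw [hmin, Finset.sum_range_succ', neg_add, Real.rpow_add hρ]
        ring
      have cover : ∀ H, fU (n + 1) (m + 1) ρ s b H ≤ ∑ x : Fin (n + 1) × Fin (m + 1),
          {H : Fin (n + 1) → Fin (m + 1) → ℂ | ∀ i j, ‖H i j‖ ≤ ‖H x.1 x.2‖}.indicator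
          (fU (n + 1) (m + 1) ρ s b) H := by
        intro H
        obtain ⟨x, hx⟩ := Finite.exists_max (fun x : Fin (n + 1) × Fin (m + 1) => ‖H x.1 x.2‖)
        have hmem : H ∈ {H : Fin (n + 1) → Fin (m + 1) → ℂ | ∀ i j, ‖H i j‖ ≤ ‖H x.1 x.2‖} :=
          fun i j => hx (i, j)
        refine le_trans (le_of_eq (Set.indicator_of_mem hmem (fU (n + 1) (m + 1) ρ s b)).symm) ?_
        exact Finset.single_le_sum (f := fun x : Fin (n + 1) × Fin (m + 1) => {H : Fin (n + 1) → Fin (m + 1) → ℂ | ∀ i j, ‖H i j‖ ≤ ‖H x.1 x.2‖}.indicator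
          (fU (n + 1) (m + 1) ρ s b) H) (fun _ _ => by simp) (Finset.mem_univ x)
      have hmeas : ∀ x : Fin (n + 1) × Fin (m + 1), Measurable
          ({H : Fin (n + 1) → Fin (m + 1) → ℂ | ∀ i j, ‖H i j‖ ≤ ‖H x.1 x.2‖}.indicator
          (fU (n + 1) (m + 1) ρ s b)) := by
        intro x
        apply (measurable_fU _ _ _ _ _).indicator
        have : {H : Fin (n + 1) → Fin (m + 1) → ℂ | ∀ i j, ‖H i j‖ ≤ ‖H x.1 x.2‖} =
          ⋂ i, ⋂ j, {H | ‖H i j‖ ≤ ‖H x.1 x.2‖} := by ext; simp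
        rw [this]
        exact MeasurableSet.iInter fun i => MeasurableSet.iInter fun j =>
          measurableSet_le (by fun_prop) (by fun_prop)
      refine (lintegral_mono cover).trans ?_
      rw [lintegral_finset_sum _ (fun x _ => hmeas x)]
      refine (Finset.sum_le_sum fun x _ => step x.1 x.2).trans (le_of_eq ?_)
      rw [Finset.sum_const, nsmul_eq_mul, ← ENNReal.ofReal_natCast, ← ENNReal.ofReal_mul (by positivity)]
      congr 1
      simp
      ring

/-- region for the lower bound -/
def RL (n m : ℕ) (K ρ : ℝ) (a : ℕ → ℝ) : Set (Fin n → Fin m → ℂ) :=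
  {H | (∀ i j, ‖H i j‖ ≤ K) ∧ Dg ρ (Matrix.of H) ≤ K * ∏ i ∈ Finset.range (min n m), (1 + ρ * a i)}

theorem meas_RL (n m : ℕ) (K ρ : ℝ) (a : ℕ → ℝ) : MeasurableSet (RL n m K ρ a) := by
  have : RL n m K ρ a = (⋂ i, ⋂ j, {H | ‖H i j‖ ≤ K}) ∩
    {H | Dg ρ (Matrix.of H) ≤ K * ∏ i ∈ Finset.range (min n m), (1 + ρ * a i)} := by
    ext; simp [RL]
  rw [this]
  refine MeasurableSet.inter (MeasurableSet.iInter fun i => MeasurableSet.iInter fun j =>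
          measurableSet_le (by fun_prop) (by fun_prop)) ?_
  exact measurableSet_le (continuous_Dg ρ).measurable measurable_const

theorem lower_main (n : ℕ) : ∀ (m : ℕ), ∃ c K : ℝ, 0 < c ∧ 1 ≤ K ∧ ∀ (ρ : ℝ) (a : ℕ → ℝ), 0 ≤ ρ →
    (∀ i, 0 < a i ∧ a i ≤ 1) →
    ENNReal.ofReal (c * ∏ i ∈ Finset.range (min n m), a i ^ (n + m - 2 * i - 1)) ≤
      volume (RL n m K ρ a) := by
  induction n with
  | zero =>
    intro m
    refine ⟨1, 1, zero_lt_one, le_refl _, fun ρ a hρ ha => ?_⟩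
    have : RL 0 m 1 ρ a = Set.univ := by
      ext H; simp [RL, Dg]
    rw [this]
    simp [volume_pi]
  | succ n ih =>
    intro m
    cases m with
    | zero =>
      refine ⟨1, 1, zero_lt_one, le_refl _, fun ρ a hρ ha => ?_⟩
      have : RL (n + 1) 0 1 ρ a = Set.univ := by
        ext H
        have : Matrix.of H * (Matrix.of H)ᴴ = 0 := by ext i j; simp [Matrix.mul_apply]
        simp [RL, Dg, this]
      rw [this, vol_univ_zero]
      simp
    | succ m =>
      obtain ⟨c, K, hc, hK, h⟩ := ih m
      have hKc := Kc_pos n m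
      refine ⟨(3 / 4 * Real.pi) * (Real.pi / 4) ^ (n + m) * c, K + 1 + Kc n m * K, by positivity,
        by nlinarith, fun ρ a hρ ha => ?_⟩
      have h0 := ha 0
      set t := Real.sqrt (a 0) / 2 with ht
      have hs0 : 0 < Real.sqrt (a 0) := Real.sqrt_pos.2 h0.1
      have hs1 : Real.sqrt (a 0) ≤ 1 := Real.sqrt_le_one.2 h0.2
      have hss : Real.sqrt (a 0) ^ 2 = a 0 := Real.sq_sqrt h0.1.le
      have ht0 : 0 < t := by positivity
      have htt : t ^ 2 = a 0 / 4 := by rw [ht, div_pow, hss]; norm_num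
      have hmin : min (n + 1) (m + 1) = min n m + 1 := by omega
      have hstep := lower_step 0 0 (RL (n + 1) (m + 1) (K + 1 + Kc n m * K) ρ a) (meas_RL _ _ _ _ _)
        (Metric.closedBall 0 (Real.sqrt (a 0)) \ Metric.ball 0 t)
        (Metric.isClosed_closedBall.measurableSet.diff Metric.isOpen_ball.measurableSet) t ht0.le
        (RL n m K ρ (fun i => a (i + 1))) (meas_RL _ _ _ _ _) ?_
      · refine le_trans ?_ hstep
        have hvol : ENNReal.ofReal (3 / 4 * Real.pi * a 0) ≤
            volume (Metric.closedBall (0 : ℂ) (Real.sqrt (a 0)) \ Metric.ball 0 t) := by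
          rw [measure_sdiff (Metric.ball_subset_closedBall.trans
            (Metric.closedBall_subset_closedBall (by rw [ht]; linarith)))
            Metric.isOpen_ball.measurableSet.nullMeasurableSet (by simp [Complex.volume_ball, ENNReal.mul_eq_top])]
          rw [Complex.volume_closedBall, Complex.volume_ball, ← ENNReal.ofReal_pow hs0.le,
            ← ENNReal.ofReal_pow ht0.le, hss, htt, ← ENNReal.ofReal_coe_nnreal, NNReal.coe_real_pi,
            ← ENNReal.ofReal_mul h0.1.le, ← ENNReal.ofReal_mul (by linarith [h0.1]),
            ← ENNReal.ofReal_sub _ (by have := h0.1; positivity)]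
          apply ENNReal.ofReal_le_ofReal
          linarith
        have hh := h ρ (fun i => a (i + 1)) hρ (fun i => ha (i + 1))
        refine le_trans (le_of_eq ?_) (mul_le_mul' (mul_le_mul' hvol le_rfl) hh)
        have hpos : ∀ i, 0 ≤ a i := fun i => (ha i).1.le
        rw [← ENNReal.ofReal_mul (by have := h0.1; positivity),
          ← ENNReal.ofReal_mul (by have := h0.1; positivity)]
        congr 1
        rw [hmin, Finset.prod_range_succ', htt]
        have e : ∀ i ∈ Finset.range (min n m), a (i + 1) ^ (n + 1 + (m + 1) - 2 * (i + 1) - 1) =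
            a (i + 1) ^ (n + m - 2 * i - 1) := by
          intro i hi
          congr 1
          omega
        rw [Finset.prod_congr rfl e]
        have e2 : n + 1 + (m + 1) - 2 * 0 - 1 = n + m + 1 := by omega
        rw [e2, pow_succ, show a 0 / 4 * Real.pi = a 0 * (Real.pi / 4) by ring, mul_pow]
        ring
      · intro p hp u v S hS hu hv
        have hp1 : ‖p‖ ≤ Real.sqrt (a 0) := by simpa using hp.1
        have hp2 : t ≤ ‖p‖ := by simpa using hp.2
        have hp0 : 0 < ‖p‖ := by linarith
        have hpne : p ≠ 0 := norm_pos_iff.1 hp0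
        have hu' : ∀ j, ‖u j‖ ≤ ‖p‖ := fun j => (hu j).trans hp2
        have hv' : ∀ j, ‖v j‖ ≤ ‖p‖ := fun j => (hv j).trans hp2
        have hKK : 0 ≤ Kc n m * K := by positivity
        refine ⟨?_, ?_⟩
        · intro i j
          rcases Fin.eq_self_or_eq_succAbove 0 i with rfl | ⟨i, rfl⟩ <;>
          rcases Fin.eq_self_or_eq_succAbove 0 j with rfl | ⟨j, rfl⟩
          · rw [asm_pp]; linarith
          · rw [asm_pu]; linarith [hu' j]
          · rw [asm_pv]; linarith [hv' i]
          · rw [asm_pW]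
            have h1 : ‖v i * u j / p‖ ≤ ‖p‖ := by
              rw [norm_div, norm_mul, div_le_iff₀ hp0]
              exact mul_le_mul (hv' i) (hu' j) (norm_nonneg _) (norm_nonneg _)
            linarith [norm_add_le (S i j) (v i * u j / p), hS.1 i j]
        · have hD := (Dg_block_bounds hρ p hpne u v (Matrix.of fun i j => S i j + v i * u j / p) hu' hv').1
          rw [Dg_asm]
          refine hD.trans ?_
          have hS2 := hS.2
          have e : (Matrix.of fun i j => (Matrix.of fun i j => S i j + v i * u j / p) i j - v i * u j / p) = Matrix.of S := by
            ext i j; simp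
          simp only [e]
          have hpa : ‖p‖ ^ 2 ≤ a 0 := by rw [← hss]; gcongr
          have hprod : 0 ≤ ∏ i ∈ Finset.range (min n m), (1 + ρ * a (i + 1)) :=
            Finset.prod_nonneg fun i _ => by have := (ha (i + 1)).1; positivity
          have h0' := h0.1
          have hDS : 0 ≤ Dg ρ (Matrix.of S) := le_trans zero_le_one (one_le_Dg hρ _)
          rw [hmin, Finset.prod_range_succ']
          calc Kc n m * ((1 + ρ * ‖p‖ ^ 2) * Dg ρ (Matrix.of S)) ≤
              Kc n m * ((1 + ρ * a 0) * (K * ∏ i ∈ Finset.range (min n m), (1 + ρ * a (i + 1)))) := by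
                gcongr
            _ = (Kc n m * K) * ((∏ i ∈ Finset.range (min n m), (1 + ρ * a (i + 1))) * (1 + ρ * a 0)) := by ring
            _ ≤ _ := by gcongr; linarith

end InductionPart


section GaussPart

theorem lint_pi_fin {α : Type*} [MeasurableSpace α] (μ : Measure α) [SigmaFinite μ] (n : ℕ) :
    ∀ (f : Fin n → α → ENNReal), (∀ i, Measurable (f i)) →
    ∫⁻ x, ∏ i, f i (x i) ∂(Measure.pi fun _ : Fin n => μ) = ∏ i, ∫⁻ x, f i x ∂μ := by
  induction n with
  | zero => intro f hf; simp
  | succ n ih =>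
    intro f hf
    have h := (measurePreserving_piFinSuccAbove (fun _ : Fin (n + 1) => μ) 0).symm
    rw [← h.lintegral_comp_emb (MeasurableEquiv.measurableEmbedding _)]
    simp_rw [Fin.prod_univ_succ]
    have e : ∀ x : α × (Fin n → α), f 0 ((MeasurableEquiv.piFinSuccAbove (fun _ : Fin (n + 1) => α) 0).symm x 0) *
        ∏ i : Fin n, f i.succ ((MeasurableEquiv.piFinSuccAbove (fun _ : Fin (n + 1) => α) 0).symm x i.succ) =
        f 0 x.1 * ∏ i : Fin n, f i.succ (x.2 i) := by
      intro x
      rfl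
    simp_rw [e]
    have hm : Measurable (fun y : Fin n → α => ∏ i : Fin n, f i.succ (y i)) :=
      Finset.measurable_prod _ fun i _ => (hf i.succ).comp (measurable_pi_apply i)
    rw [lintegral_prod_mul (hf 0).aemeasurable hm.aemeasurable]
    rw [ih _ fun i => hf i.succ]

theorem pi_withDensity_fin {α : Type*} [MeasurableSpace α] (μ : Measure α) [SigmaFinite μ] (n : ℕ)
    (f : α → ENNReal) (hf : Measurable f) [SigmaFinite (μ.withDensity f)] :
    Measure.pi (fun _ : Fin n => μ.withDensity f) =
      (Measure.pi fun _ : Fin n => μ).withDensity (fun x => ∏ i, f (x i)) := by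
  refine Measure.pi_eq fun s hs => ?_
  rw [withDensity_apply _ (MeasurableSet.univ_pi hs), ← lintegral_indicator (MeasurableSet.univ_pi hs)]
  have e : ∀ x : Fin n → α, (Set.univ.pi s).indicator (fun x => ∏ i, f (x i)) x =
      ∏ i, (s i).indicator f (x i) := by
    intro x
    by_cases hx : x ∈ Set.univ.pi s
    · rw [Set.indicator_of_mem hx]
      exact Finset.prod_congr rfl fun i _ => (Set.indicator_of_mem (hx i trivial) _).symm
    · rw [Set.indicator_of_notMem hx]
      simp only [Set.mem_univ_pi, not_forall] at hx
      obtain ⟨i, hi⟩ := hx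
      exact (Finset.prod_eq_zero (Finset.mem_univ i) (Set.indicator_of_notMem hi _)).symm
  simp_rw [e]
  rw [lint_pi_fin μ n _ fun i => hf.indicator (hs i)]
  refine Finset.prod_congr rfl fun i _ => ?_
  rw [lintegral_indicator (hs i), withDensity_apply _ (hs i)]

theorem mp_curry {ι κ X : Type*} [Fintype ι] [Fintype κ] [MeasurableSpace X] (μ : Measure X)
    [SigmaFinite μ] :
    MeasurePreserving (MeasurableEquiv.curry ι κ X) (Measure.pi fun _ : ι × κ => μ)
      (Measure.pi fun _ : ι => Measure.pi fun _ : κ => μ) := by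
  have h : MeasurePreserving (MeasurableEquiv.curry ι κ X).symm
      (Measure.pi fun _ : ι => Measure.pi fun _ : κ => μ) (Measure.pi fun _ : ι × κ => μ) := by
    refine ⟨MeasurableEquiv.measurable _, ?_⟩
    refine (Measure.pi_eq fun s hs => ?_).symm
    rw [MeasurableEquiv.map_apply]
    have : (MeasurableEquiv.curry ι κ X).symm ⁻¹' (Set.univ.pi s) =
        Set.univ.pi fun i => Set.univ.pi fun j => s (i, j) := by
      ext x
      simp [MeasurableEquiv.coe_curry_symm, Function.uncurry]
    rw [this, Measure.pi_pi]
    simp_rw [Measure.pi_pi]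
    rw [Fintype.prod_prod_type]
  exact h.symm

/-- density of the standard complex Gaussian -/
noncomputable def gd (z : ℂ) : ENNReal := ENNReal.ofReal (Real.pi⁻¹ * Real.exp (-‖z‖ ^ 2))

/-- standard complex Gaussian -/
noncomputable def gC : Measure ℂ := (volume : Measure ℂ).withDensity gd

theorem measurable_gd : Measurable gd := by unfold gd; fun_prop

theorem mp_gC : MeasurePreserving (fun x : Bool → ℝ => (⟨x true, x false⟩ : ℂ))
    (Measure.pi fun _ : Bool => gaussianReal 0 (1/2)) gC := by
  have h1 : MeasurePreserving (fun x : Bool → ℝ => (x true, x false))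
      (Measure.pi fun _ : Bool => gaussianReal 0 (1/2))
      ((gaussianReal 0 (1/2)).prod (gaussianReal 0 (1/2))) := by
    refine ⟨by fun_prop, ?_⟩
    refine (Measure.prod_eq fun s t hs ht => ?_).symm
    rw [Measure.map_apply (by fun_prop) (hs.prod ht)]
    have : (fun x : Bool → ℝ => (x true, x false)) ⁻¹' (s ×ˢ t) =
        Set.univ.pi (fun b : Bool => if b then s else t) := by
      ext x; simp [and_comm]
    rw [this, Measure.pi_pi]
    simp
  have h2 : MeasurePreserving Complex.measurableEquivRealProd.symm
      ((gaussianReal 0 (1/2)).prod (gaussianReal 0 (1/2))) gC := by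
    refine ⟨MeasurableEquiv.measurable _, ?_⟩
    rw [gaussianReal_of_var_ne_zero _ (by norm_num), prod_withDensity (by fun_prop) (by fun_prop)]
    ext s hs
    rw [MeasurableEquiv.map_apply, withDensity_apply _ (MeasurableEquiv.measurable _ hs), gC,
      withDensity_apply _ hs]
    rw [← Complex.volume_preserving_equiv_real_prod.symm.setLIntegral_comp_preimage_emb
      (MeasurableEquiv.measurableEmbedding _)]
    refine lintegral_congr fun x => ?_
    unfold gaussianPDF gd
    rw [← ENNReal.ofReal_mul (gaussianPDFReal_nonneg _ _ _)]
    congr 1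
    rw [Complex.measurableEquivRealProd_symm_apply]
    unfold gaussianPDFReal
    rw [Complex.sq_norm, Complex.normSq_mk]
    have e : (2 : ℝ) * Real.pi * ((1 / 2 : NNReal) : ℝ) = Real.pi := by push_cast; ring
    have e' : (2 : ℝ) * ((1 / 2 : NNReal) : ℝ) = 1 := by push_cast; ring
    rw [e, e']
    have hp : (Real.sqrt Real.pi)⁻¹ * (Real.sqrt Real.pi)⁻¹ = Real.pi⁻¹ := by
      rw [← mul_inv, Real.mul_self_sqrt Real.pi_pos.le]
    rw [← hp, mul_mul_mul_comm, ← Real.exp_add]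
    congr 2
    ring
  exact h2.comp h1

instance : IsProbabilityMeasure gC := by
  rw [← mp_gC.map_eq]
  exact Measure.isProbabilityMeasure_map mp_gC.measurable.aemeasurable

/-- law of the Gaussian matrix -/
noncomputable def gM (n m : ℕ) : Measure (Fin n → Fin m → ℂ) :=
  Measure.pi fun _ => Measure.pi fun _ => gC

instance (n m : ℕ) : IsProbabilityMeasure (gM n m) := by unfold gM; infer_instance

theorem gM_eq (n m : ℕ) : gM n m = volume.withDensity (fun H => ∏ i, ∏ j, gd (H i j)) := by
  have h1 : (Measure.pi fun _ : Fin m => gC) =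
      (volume : Measure (Fin m → ℂ)).withDensity (fun x => ∏ i, gd (x i)) := by
    have : SigmaFinite ((volume : Measure ℂ).withDensity gd) := by
      change SigmaFinite gC; infer_instance
    exact pi_withDensity_fin _ _ _ measurable_gd
  unfold gM
  rw [h1]
  have : SigmaFinite ((volume : Measure (Fin m → ℂ)).withDensity (fun x => ∏ i, gd (x i))) := by
    rw [← h1]; infer_instance
  exact pi_withDensity_fin _ _ _ (Finset.measurable_prod _ fun i _ => measurable_gd.comp (measurable_pi_apply i))

theorem prod_gd {n m : ℕ} (H : Fin n → Fin m → ℂ) : ∏ i, ∏ j, gd (H i j) =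
    ENNReal.ofReal (Real.pi⁻¹ ^ (m * n) * Real.exp (-1 * ∑ i, ∑ j, ‖H i j‖ ^ 2)) := by
  unfold gd
  have h : ∀ i, ∏ j, ENNReal.ofReal (Real.pi⁻¹ * Real.exp (-‖H i j‖ ^ 2)) =
      ENNReal.ofReal (∏ j, (Real.pi⁻¹ * Real.exp (-‖H i j‖ ^ 2))) := fun i =>
    (ENNReal.ofReal_prod_of_nonneg fun j _ => by have := Real.pi_pos; positivity).symm
  simp_rw [h]
  rw [← ENNReal.ofReal_prod_of_nonneg fun i _ => Finset.prod_nonneg fun j _ => by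
    have := Real.pi_pos; positivity]
  congr 1
  simp_rw [Finset.prod_mul_distrib, ← Real.exp_sum]
  simp [pow_mul]

/-- joint law -/
theorem law_main {Ω : Type*} [MeasurableSpace Ω] (P : Measure Ω) [IsProbabilityMeasure P]
    (M1 M2 M3 L : ℕ)
    (H1 : ℕ → Ω → Matrix (Fin M2) (Fin M1) ℂ) (H2 : ℕ → Ω → Matrix (Fin M3) (Fin M2) ℂ)
    (hGauss : Measure.map
      (fun ω (p : ((Fin L × Fin M2 × Fin M1) ⊕ (Fin L × Fin M3 × Fin M2)) × Bool) =>
        Sum.elim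
          (fun q => if p.2 then (H1 q.1 ω q.2.1 q.2.2).re else (H1 q.1 ω q.2.1 q.2.2).im)
          (fun q => if p.2 then (H2 q.1 ω q.2.1 q.2.2).re else (H2 q.1 ω q.2.1 q.2.2).im)
          p.1) P
      = Measure.pi (fun _ => gaussianReal 0 (1/2))) :
    AEMeasurable (fun ω => ((fun (l : Fin L) i j => H1 l ω i j, fun (l : Fin L) i j => H2 l ω i j) :
        (Fin L → Fin M2 → Fin M1 → ℂ) × (Fin L → Fin M3 → Fin M2 → ℂ))) P ∧
    Measure.map (fun ω => ((fun (l : Fin L) i j => H1 l ω i j, fun (l : Fin L) i j => H2 l ω i j) :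
        (Fin L → Fin M2 → Fin M1 → ℂ) × (Fin L → Fin M3 → Fin M2 → ℂ))) P =
      (Measure.pi fun _ => gM M2 M1).prod (Measure.pi fun _ => gM M3 M2) := by
  have hF := AEMeasurable.of_map_ne_zero (by rw [hGauss]; exact IsProbabilityMeasure.ne_zero _)
  have m1 := mp_curry (ι := (Fin L × Fin M2 × Fin M1) ⊕ (Fin L × Fin M3 × Fin M2)) (κ := Bool)
    (gaussianReal 0 (1/2))
  have m2 := measurePreserving_pi
    (fun _ : (Fin L × Fin M2 × Fin M1) ⊕ (Fin L × Fin M3 × Fin M2) => Measure.pi fun _ : Bool => gaussianReal 0 (1/2))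
    (fun _ => gC) (fun _ => mp_gC)
  have m3 := measurePreserving_sumPiEquivProdPi
    (fun _ : (Fin L × Fin M2 × Fin M1) ⊕ (Fin L × Fin M3 × Fin M2) => gC)
  have m4 : ∀ a b : ℕ, MeasurePreserving
      (fun (x : Fin L × Fin a × Fin b → ℂ) (l : Fin L) (i : Fin a) (j : Fin b) => x (l, i, j))
      (Measure.pi fun _ => gC) (Measure.pi fun _ => gM a b) := by
    intro a b
    have := (measurePreserving_pi (fun _ : Fin L => Measure.pi fun _ : Fin a × Fin b => gC)
      (fun _ => gM a b) (fun _ => mp_curry gC)).comp (mp_curry (ι := Fin L) (κ := Fin a × Fin b) gC)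
    exact this
  have m5 := (m4 M2 M1).prod (m4 M3 M2)
  have m := m5.comp (m3.comp (m2.comp m1))
  refine ⟨m.measurable.comp_aemeasurable hF, ?_⟩
  rw [← m.map_eq, ← hGauss, AEMeasurable.map_map_of_aemeasurable m.measurable.aemeasurable hF]
  rfl

end GaussPart


section DmtPart

theorem sum_tele (n m k d : ℕ) : ∑ i ∈ Finset.range d, ((n : ℝ) + m - 2 * ((k + i : ℕ) : ℝ) - 1) =
    ((n : ℝ) - k) * (m - k) - ((n : ℝ) - k - d) * (m - k - d) := by
  induction d with
  | zero => simp
  | succ d ih => rw [Finset.sum_range_succ, ih]; push_cast; ring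

theorem dmt_end (n m N : ℕ) (hN : N = min n m) : ((n : ℝ) - N) * (m - N) = 0 := by
  rcases le_total n m with h | h
  · rw [min_eq_left h] at hN; subst hN; simp
  · rw [min_eq_right h] at hN; subst hN; simp

theorem dmt_sum_upper (n m : ℕ) (x : ℝ) (hx0 : 0 ≤ x) (hx : x < ((min n m : ℕ) : ℝ)) :
    ∑ i ∈ Finset.range (min n m), min ((n : ℝ) + m - 2 * ⌊x⌋₊ - 1) ((n : ℝ) + m - 2 * i - 1) =
      dmt m n x + ((n : ℝ) + m - 2 * ⌊x⌋₊ - 1) * x := by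
  have hk : ⌊x⌋₊ < min n m := (Nat.floor_lt hx0).2 hx
  set k := ⌊x⌋₊ with hkd
  obtain ⟨d, hd⟩ : ∃ d, min n m = k + d := ⟨min n m - k, by omega⟩
  have hend := dmt_end n m (k + d) hd.symm
  push_cast at hend
  rw [hd, Finset.sum_range_add]
  have e1 : ∑ i ∈ Finset.range k, min ((n : ℝ) + m - 2 * k - 1) ((n : ℝ) + m - 2 * i - 1) =
      ∑ i ∈ Finset.range k, ((n : ℝ) + m - 2 * k - 1) := by
    refine Finset.sum_congr rfl fun i hi => min_eq_left ?_
    have : (i : ℝ) ≤ k := by exact_mod_cast (Finset.mem_range.1 hi).le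
    linarith
  have e2 : ∑ i ∈ Finset.range d, min ((n : ℝ) + m - 2 * k - 1) ((n : ℝ) + m - 2 * ((k + i : ℕ) : ℝ) - 1) =
      ∑ i ∈ Finset.range d, ((n : ℝ) + m - 2 * ((k + i : ℕ) : ℝ) - 1) := by
    refine Finset.sum_congr rfl fun i hi => min_eq_right ?_
    push_cast
    have : (0 : ℝ) ≤ i := by positivity
    linarith
  rw [e1, e2, sum_tele, Finset.sum_const, Finset.card_range, nsmul_eq_mul]
  unfold dmt dmtPt
  rw [if_neg (by rw [min_comm]; exact not_le.2 hx), ← hkd]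
  push_cast
  linear_combination -hend

/-- exponents -/
noncomputable def al (x : ℝ) (i : ℕ) : ℝ := min 1 (max 0 ((i : ℝ) + 1 - x))

theorem al_nonneg (x : ℝ) (i : ℕ) : 0 ≤ al x i := le_min zero_le_one (le_max_left _ _)

theorem al_le_one (x : ℝ) (i : ℕ) : al x i ≤ 1 := min_le_left _ _

theorem dmt_sum_lower (n m : ℕ) (x : ℝ) (hx0 : 0 ≤ x) :
    ∑ i ∈ Finset.range (min n m), al x i * ((n : ℝ) + m - 2 * i - 1) = dmt m n x := by
  by_cases hx : ((min m n : ℕ) : ℝ) ≤ x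
  · unfold dmt
    rw [if_pos hx]
    refine Finset.sum_eq_zero fun i hi => ?_
    have : ((i + 1 : ℕ) : ℝ) ≤ (min m n : ℕ) := by
      rw [min_comm]
      exact_mod_cast Finset.mem_range.1 hi
    push_cast at this hx
    have h0 : al x i = 0 := by
      unfold al
      rw [max_eq_left (by linarith), min_eq_right zero_le_one]
    rw [h0, zero_mul]
  · have hx' : x < ((min n m : ℕ) : ℝ) := by rw [min_comm]; exact not_le.1 hx
    have hk : ⌊x⌋₊ < min n m := (Nat.floor_lt hx0).2 hx'
    have hkx := Nat.floor_le hx0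
    have hkx' := Nat.lt_floor_add_one x
    unfold dmt dmtPt
    rw [if_neg hx]
    set k := ⌊x⌋₊ with hkd
    obtain ⟨d, hd⟩ : ∃ d, min n m = (k + 1) + d := ⟨min n m - (k + 1), by omega⟩
    have hend := dmt_end n m (k + 1 + d) hd.symm
    push_cast at hend
    rw [hd, Finset.sum_range_add, Finset.sum_range_succ]
    have e1 : ∑ i ∈ Finset.range k, al x i * ((n : ℝ) + m - 2 * i - 1) = 0 := by
      refine Finset.sum_eq_zero fun i hi => ?_
      have : ((i + 1 : ℕ) : ℝ) ≤ k := by exact_mod_cast Finset.mem_range.1 hi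
      push_cast at this
      have h0 : al x i = 0 := by
        unfold al
        rw [max_eq_left (by linarith), min_eq_right zero_le_one]
      rw [h0, zero_mul]
    have e2 : ∑ i ∈ Finset.range d, al x (k + 1 + i) * ((n : ℝ) + m - 2 * ((k + 1 + i : ℕ) : ℝ) - 1) =
        ∑ i ∈ Finset.range d, ((n : ℝ) + m - 2 * ((k + 1 + i : ℕ) : ℝ) - 1) := by
      refine Finset.sum_congr rfl fun i hi => ?_
      have h1 : al x (k + 1 + i) = 1 := by
        unfold al
        have : (0 : ℝ) ≤ i := by positivity
        push_cast
        rw [max_eq_right (by linarith), min_eq_left (by linarith)]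
      rw [h1, one_mul]
    have e3 : al x k = k + 1 - x := by
      unfold al
      rw [max_eq_right (by linarith), min_eq_right (by linarith)]
    rw [e1, e2, e3, sum_tele]
    push_cast
    linear_combination -hend

theorem al_sum (x : ℝ) (hx : 0 ≤ x) (j : ℕ) : ∑ i ∈ Finset.range j, (1 - al x i) ≤ min (j : ℝ) x := by
  induction j with
  | zero => simp [hx]
  | succ j ih =>
    rw [Finset.sum_range_succ]
    unfold al at *
    push_cast
    rcases le_total x j with h | h
    · rw [min_eq_right h] at ih
      rw [max_eq_right (by linarith), min_eq_left (by linarith), min_eq_right (by linarith)]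
      linarith
    · rw [min_eq_left h] at ih
      rcases le_total x (j + 1) with h' | h'
      · rw [max_eq_right (by linarith), min_eq_right (by linarith), min_eq_right (by linarith)]
        linarith
      · rw [max_eq_left (by linarith), min_eq_right (by linarith), min_eq_left (by linarith)]
        linarith

theorem al_sum_lt (x δ : ℝ) (hδ : 0 < δ) (hδ1 : δ ≤ 1) (hδx : δ ≤ x) (N : ℕ) (hN : 0 < N) :
    ∑ i ∈ Finset.range N, max 0 (1 - al x i - δ) ≤ x - δ := by
  have h := (al_sum x (by linarith) N).trans (min_le_right _ _)
  obtain ⟨N, rfl⟩ : ∃ k, N = k + 1 := ⟨N - 1, by omega⟩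
  rw [Finset.sum_range_succ'] at *
  have h1 : ∑ i ∈ Finset.range N, max 0 (1 - al x (i + 1) - δ) ≤ ∑ i ∈ Finset.range N, (1 - al x (i + 1)) :=
    Finset.sum_le_sum fun i _ => max_le (by linarith [al_le_one x (i + 1)]) (by linarith)
  have h2 : max 0 (1 - al x 0 - δ) = 1 - al x 0 - δ := by
    apply max_eq_right
    unfold al
    rcases le_total x 1 with h' | h'
    · rw [max_eq_right (by simp; linarith), min_eq_right (by simp; linarith)]
      simp; linarith
    · rw [max_eq_left (by simp; linarith), min_eq_right (by linarith)]
      linarith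
  linarith

theorem sum_odd (n m : ℕ) : ∑ i ∈ Finset.range (min n m), ((n : ℝ) + m - 2 * i - 1) = n * m := by
  have h := sum_tele n m 0 (min n m)
  have h2 := dmt_end n m _ rfl
  simp only [zero_add, CharP.cast_eq_zero, sub_zero] at h
  rw [h, h2]
  ring

end DmtPart


section OneChannel

theorem ev_rpow_ge (c δ : ℝ) (hδ : 0 < δ) : ∀ᶠ ρ : ℝ in Filter.atTop, c < ρ ^ δ :=
  (tendsto_rpow_atTop hδ).eventually_gt_atTop c

theorem up1 (n m : ℕ) (x : ℝ) (hx0 : 0 ≤ x) (hx : x < ((min n m : ℕ) : ℝ)) (ε : ℝ) (hε : 0 < ε) :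
    ∃ C : ℝ, 0 ≤ C ∧ ∀ ρ : ℝ, 1 ≤ ρ →
      ∫⁻ H, ENNReal.ofReal (Dg ρ (Matrix.of H) ^ (-((n : ℝ) + m - 2 * ⌊x⌋₊ - 1))) ∂(gM n m) ≤
      ENNReal.ofReal (C * ρ ^ (-(dmt m n x + ((n : ℝ) + m - 2 * ⌊x⌋₊ - 1) * x) + ε)) := by
  have hk : ⌊x⌋₊ < min n m := (Nat.floor_lt hx0).2 hx
  have hsum := dmt_sum_upper n m x hx0 hx
  have hge : ∀ i < min n m, (1 : ℝ) ≤ (n : ℝ) + m - 2 * i - 1 := by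
    intro i hi
    have : 2 * i + 2 ≤ n + m := by omega
    have : ((2 * i + 2 : ℕ) : ℝ) ≤ (n + m : ℕ) := by exact_mod_cast this
    push_cast at this
    linarith
  have hs := hge _ hk
  set s := (n : ℝ) + m - 2 * ⌊x⌋₊ - 1 with hsd
  have hNpos : (0 : ℝ) < min n m + 1 := by positivity
  set e := min 1 (ε / (min n m + 1)) with he
  have he0 : 0 < e := lt_min zero_lt_one (by positivity)
  obtain ⟨C, hC, h⟩ := upper_main n m s 1 (fun i => min s ((n : ℝ) + m - 2 * i - 1) - e)
    (by linarith) zero_lt_one (by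
      intro i hi
      have h1 := hge i hi
      have h2 : e ≤ 1 := min_le_left _ _
      have h3 : 1 ≤ min s ((n : ℝ) + m - 2 * i - 1) := le_min hs h1
      have h4 := min_le_left s ((n : ℝ) + m - 2 * i - 1)
      have h5 := min_le_right s ((n : ℝ) + m - 2 * i - 1)
      refine ⟨by linarith, by linarith, by linarith⟩)
  have hpi := Real.pi_pos
  refine ⟨Real.pi⁻¹ ^ (m * n) * C, by positivity, fun ρ hρ => ?_⟩
  have hρ0 : 0 < ρ := by linarith
  have hmD := (continuous_Dg (n := n) (m := m) ρ).measurable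
  have hmg : Measurable (fun H : Fin n → Fin m → ℂ => ∏ i, ∏ j, gd (H i j)) := by
    refine Finset.measurable_prod _ fun i _ => Finset.measurable_prod _ fun j _ => ?_
    exact measurable_gd.comp (by fun_prop)
  rw [gM_eq, lintegral_withDensity_eq_lintegral_mul _ hmg (by fun_prop)]
  calc _ = ∫⁻ H, ENNReal.ofReal (Real.pi⁻¹ ^ (m * n)) * fU n m ρ s 1 H := by
        refine lintegral_congr fun H => ?_
        have hD := one_le_Dg hρ0.le (Matrix.of H)
        rw [Pi.mul_apply, prod_gd, fU, ← ENNReal.ofReal_mul (by positivity),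
          ← ENNReal.ofReal_mul (by positivity)]
        congr 1; ring
    _ = ENNReal.ofReal (Real.pi⁻¹ ^ (m * n)) * ∫⁻ H, fU n m ρ s 1 H :=
        lintegral_const_mul _ (measurable_fU _ _ _ _ _)
    _ ≤ ENNReal.ofReal (Real.pi⁻¹ ^ (m * n)) * ENNReal.ofReal (C * ρ ^ (-∑ i ∈ Finset.range (min n m), (min s ((n : ℝ) + m - 2 * i - 1) - e))) := by
        gcongr; exact h ρ hρ0
    _ ≤ _ := by
        rw [← ENNReal.ofReal_mul (by positivity), mul_assoc]
        apply ENNReal.ofReal_le_ofReal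
        gcongr ?_ * (?_ * ?_)
        apply Real.rpow_le_rpow_of_exponent_le hρ
        rw [Finset.sum_sub_distrib, hsum, Finset.sum_const, Finset.card_range, nsmul_eq_mul]
        have h1 : ((min n m : ℕ) : ℝ) * e ≤ ε := by
          calc ((min n m : ℕ) : ℝ) * e ≤ ((min n m : ℕ) : ℝ) * (ε / (min n m + 1)) := by
                gcongr; exact min_le_right _ _
            _ ≤ (min n m + 1) * (ε / (min n m + 1)) := by
                gcongr; push_cast; linarith
            _ = ε := by field_simp
        linarith

theorem low1 (n m : ℕ) (hn : 0 < n) (hm : 0 < m) (x : ℝ) (hx0 : 0 < x) (ε : ℝ) (hε : 0 < ε)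
    (M : ℕ) (hM : 0 < M) :
    ∀ᶠ ρ : ℝ in Filter.atTop, ENNReal.ofReal (ρ ^ (-(dmt m n x) - ε)) ≤
      gM n m {H | Dg (ρ / M) (Matrix.of H) < ρ ^ x} := by
  obtain ⟨c, K, hc, hK, h⟩ := lower_main n m
  have hpi := Real.pi_pos
  set N := min n m with hN
  have hNpos : 0 < N := by omega
  set δ := min (min 1 x) (ε / (2 * (n * m + 1))) with hδd
  have hδ : 0 < δ := lt_min (lt_min zero_lt_one hx0) (by positivity)
  have hδ1 : δ ≤ 1 := (min_le_left _ _).trans (min_le_left _ _)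
  have hδx : δ ≤ x := (min_le_left _ _).trans (min_le_right _ _)
  have hδe : δ * (n * m) ≤ ε / 2 := by
    calc δ * (n * m) ≤ (ε / (2 * (n * m + 1))) * (n * m + 1) := by
          gcongr
          · exact min_le_right _ _
          · linarith
      _ = ε / 2 := by field_simp
  set c' := Real.pi⁻¹ ^ (m * n) * Real.exp (-1 * (n * m * K ^ 2)) * c with hc'
  have hc'0 : 0 < c' := by positivity
  filter_upwards [ev_rpow_ge (K * 2 ^ N) δ hδ, ev_rpow_ge c'⁻¹ (ε / 2) (by positivity),
    Filter.eventually_ge_atTop 1] with ρ h1 h2 hρ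
  have hρ0 : 0 < ρ := by linarith
  have hMr : (1 : ℝ) ≤ M := by exact_mod_cast hM
  have hρM : ρ / M ≤ ρ := div_le_self hρ0.le hMr
  have hh := h (ρ / M) (fun i => ρ ^ (-(al x i) - δ)) (by positivity) (fun i => ⟨by positivity,
    Real.rpow_le_one_of_one_le_of_nonpos hρ (by linarith [al_nonneg x i])⟩)
  set RR := RL n m K (ρ / M) (fun i => ρ ^ (-(al x i) - δ)) with hRR
  have hsub : RR ⊆ {H | Dg (ρ / M) (Matrix.of H) < ρ ^ x} := by
    intro H hH
    refine lt_of_le_of_lt hH.2 ?_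
    have e1 : ∏ i ∈ Finset.range N, (1 + ρ / M * ρ ^ (-(al x i) - δ)) ≤
        ∏ i ∈ Finset.range N, (2 * ρ ^ (max 0 (1 - al x i - δ))) := by
      refine Finset.prod_le_prod (fun i _ => by positivity) fun i _ => ?_
      have a1 : ρ / M * ρ ^ (-(al x i) - δ) ≤ ρ ^ (max 0 (1 - al x i - δ)) := by
        calc ρ / M * ρ ^ (-(al x i) - δ) ≤ ρ ^ (1 : ℝ) * ρ ^ (-(al x i) - δ) := by
              rw [Real.rpow_one]; gcongr
          _ = ρ ^ (1 - al x i - δ) := by rw [← Real.rpow_add hρ0]; congr 1; ring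
          _ ≤ _ := Real.rpow_le_rpow_of_exponent_le hρ (le_max_right _ _)
      have a2 : 1 ≤ ρ ^ (max 0 (1 - al x i - δ)) := Real.one_le_rpow hρ (le_max_left _ _)
      linarith
    have e2 : ∏ i ∈ Finset.range N, (2 * ρ ^ (max 0 (1 - al x i - δ))) =
        2 ^ N * ρ ^ (∑ i ∈ Finset.range N, max 0 (1 - al x i - δ)) := by
      rw [Finset.prod_mul_distrib, Finset.prod_const, Finset.card_range, Real.rpow_sum_of_pos hρ0]
    have e3 : ρ ^ (∑ i ∈ Finset.range N, max 0 (1 - al x i - δ)) ≤ ρ ^ (x - δ) :=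
      Real.rpow_le_rpow_of_exponent_le hρ (al_sum_lt x δ hδ hδ1 hδx N hNpos)
    calc K * ∏ i ∈ Finset.range N, (1 + ρ / M * ρ ^ (-(al x i) - δ)) ≤ K * (2 ^ N * ρ ^ (x - δ)) := by
          rw [e2] at e1
          have : (2 : ℝ) ^ N * ρ ^ (∑ i ∈ Finset.range N, max 0 (1 - al x i - δ)) ≤ 2 ^ N * ρ ^ (x - δ) := by
            gcongr
          gcongr
          exact e1.trans this
      _ = (K * 2 ^ N) * ρ ^ (x - δ) := by ring
      _ < ρ ^ δ * ρ ^ (x - δ) := by gcongr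
      _ = ρ ^ x := by rw [← Real.rpow_add hρ0]; congr 1; ring
  refine le_trans ?_ (measure_mono hsub)
  rw [gM_eq, withDensity_apply _ (meas_RL _ _ _ _ _)]
  have hlow : ∫⁻ _ in RR, ENNReal.ofReal (Real.pi⁻¹ ^ (m * n) * Real.exp (-1 * (n * m * K ^ 2))) ≤
      ∫⁻ H in RR, ∏ i, ∏ j, gd (H i j) := by
    refine setLIntegral_mono' (meas_RL _ _ _ _ _) fun H hH => ?_
    rw [prod_gd]
    apply ENNReal.ofReal_le_ofReal
    gcongr ?_ * Real.exp ?_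
    have : ∑ i, ∑ j, ‖H i j‖ ^ 2 ≤ n * m * K ^ 2 := by
      calc ∑ i, ∑ j, ‖H i j‖ ^ 2 ≤ ∑ i : Fin n, ∑ j : Fin m, K ^ 2 :=
            Finset.sum_le_sum fun i _ => Finset.sum_le_sum fun j _ => by
              have := hH.1 i j
              gcongr
        _ = n * m * K ^ 2 := by simp; ring
    linarith
  refine le_trans ?_ hlow
  rw [setLIntegral_const]
  refine le_trans ?_ (mul_le_mul' le_rfl hh)
  rw [← ENNReal.ofReal_mul (by positivity)]
  apply ENNReal.ofReal_le_ofReal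
  have e4 : ∏ i ∈ Finset.range N, (ρ ^ (-(al x i) - δ)) ^ (n + m - 2 * i - 1) =
      ρ ^ (-(dmt m n x) - δ * (n * m)) := by
    have : ∀ i ∈ Finset.range N, (ρ ^ (-(al x i) - δ)) ^ (n + m - 2 * i - 1) =
        ρ ^ (-(al x i * ((n : ℝ) + m - 2 * i - 1)) - δ * ((n : ℝ) + m - 2 * i - 1)) := by
      intro i hi
      have hi := Finset.mem_range.1 hi
      rw [← Real.rpow_mul_natCast hρ0.le]
      congr 1
      have : ((n + m - 2 * i - 1 : ℕ) : ℝ) = (n : ℝ) + m - 2 * i - 1 := by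
        rw [Nat.cast_sub (by omega), Nat.cast_sub (by omega)]; push_cast; ring
      rw [this]; ring
    rw [Finset.prod_congr rfl this, ← Real.rpow_sum_of_pos hρ0, Finset.sum_sub_distrib,
      Finset.sum_neg_distrib, dmt_sum_lower n m x hx0.le, ← Finset.mul_sum, sum_odd]
  rw [e4, ← mul_assoc, ← hc']
  have hci : c'⁻¹ * c' = 1 := inv_mul_cancel₀ hc'0.ne'
  calc ρ ^ (-(dmt m n x) - ε) = (c'⁻¹ * c') * ρ ^ (-(dmt m n x) - ε) := by rw [hci, one_mul]
    _ ≤ (ρ ^ (ε / 2) * c') * ρ ^ (-(dmt m n x) - ε) := by gcongr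
    _ = c' * ρ ^ (-(dmt m n x) - ε / 2) := by
        rw [mul_comm (ρ ^ (ε / 2)) c', mul_assoc, ← Real.rpow_add hρ0]; congr 2; ring
    _ ≤ _ := by
        gcongr

/-- the outage event after `K` rounds -/
def GE (L n m K M : ℕ) (ρ R : ℝ) : Set (Fin L → Fin n → Fin m → ℂ) :=
  {h | ∑ l : Fin L, (if (l : ℕ) < K then Real.log (Dg (ρ / M) (Matrix.of (h l))) else 0) < R}

theorem meas_GE (L n m K M : ℕ) (ρ R : ℝ) : MeasurableSet (GE L n m K M ρ R) := by
  unfold GE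
  refine measurableSet_lt ?_ measurable_const
  refine Finset.measurable_sum _ fun l _ => ?_
  split_ifs
  · exact ((continuous_Dg (ρ / M)).measurable.comp (measurable_pi_apply l)).log
  · exact measurable_const

theorem sum_fin_ite (L K : ℕ) (hK : K ≤ L) (f : ℕ → ℝ) :
    ∑ l : Fin L, (if (l : ℕ) < K then f l else 0) = ∑ l ∈ Finset.range K, f l := by
  rw [Fin.sum_univ_eq_sum_range (fun l => if l < K then f l else 0) L, ← Finset.sum_filter]
  congr 1
  ext l
  simp only [Finset.mem_filter, Finset.mem_range]
  omega

theorem prod_fin_ite (L K : ℕ) (hK : K ≤ L) (c : ENNReal) :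
    ∏ l : Fin L, (if (l : ℕ) < K then c else 1) = c ^ K := by
  rw [Fin.prod_univ_eq_prod_range (fun l => if l < K then c else 1) L, ← Finset.prod_filter]
  have : (Finset.range L).filter (fun l => l < K) = Finset.range K := by
    ext l
    simp only [Finset.mem_filter, Finset.mem_range]
    omega
  rw [this, Finset.prod_const, Finset.card_range]

theorem low2 (L n m K M : ℕ) (hn : 0 < n) (hm : 0 < m) (hK : K ≤ L) (hM : 0 < M) (r : ℝ) (hr : 0 < r)
    (ε : ℝ) (hε : 0 < ε) :
    ∀ᶠ ρ : ℝ in Filter.atTop, ENNReal.ofReal (ρ ^ (-(ldmtDiv m n r K) - ε)) ≤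
      (Measure.pi fun _ : Fin L => gM n m) (GE L n m K M ρ (r * Real.log ρ)) := by
  rcases Nat.eq_zero_or_pos K with rfl | hKpos
  · filter_upwards [Filter.eventually_gt_atTop 1] with ρ hρ
    have : GE L n m 0 M ρ (r * Real.log ρ) = Set.univ := by
      ext h
      simp only [GE, not_lt_zero, if_false, Finset.sum_const_zero]
      simp [mul_pos hr (Real.log_pos hρ)]
    rw [this, measure_univ, ENNReal.ofReal_le_one]
    apply Real.rpow_le_one_of_one_le_of_nonpos hρ.le
    simp [ldmtDiv]; linarith
  · have hKr : (0 : ℝ) < K := by exact_mod_cast hKpos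
    filter_upwards [low1 n m hn hm (r / K) (by positivity) (ε / K) (by positivity) M hM,
      Filter.eventually_gt_atTop 1] with ρ h hρ
    have hρ0 : 0 < ρ := by linarith
    set S := {H : Fin n → Fin m → ℂ | Dg (ρ / M) (Matrix.of H) < ρ ^ (r / K)} with hS
    have hsub : Set.univ.pi (fun l : Fin L => if (l : ℕ) < K then S else Set.univ) ⊆
        GE L n m K M ρ (r * Real.log ρ) := by
      intro g hg
      have hlt : ∀ l : Fin L, (l : ℕ) < K →
          Real.log (Dg (ρ / M) (Matrix.of (g l))) < r / K * Real.log ρ := by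
        intro l hl
        have h1 := hg l trivial
        simp only [if_pos hl] at h1
        have h2 : Dg (ρ / M) (Matrix.of (g l)) < ρ ^ (r / K) := h1
        rw [← Real.log_rpow hρ0]
        exact Real.log_lt_log (lt_of_lt_of_le zero_lt_one (one_le_Dg (by positivity) _)) h2
      have hlt2 : ∑ l : Fin L, (if (l : ℕ) < K then Real.log (Dg (ρ / M) (Matrix.of (g l))) else 0) <
          ∑ l : Fin L, (if (l : ℕ) < K then r / K * Real.log ρ else 0) := by
        refine Finset.sum_lt_sum (fun l _ => ?_) ⟨⟨0, by omega⟩, Finset.mem_univ _, ?_⟩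
        · split_ifs with hl
          · exact (hlt l hl).le
          · exact le_rfl
        · simp only [if_pos hKpos]
          exact hlt _ hKpos
      rw [sum_fin_ite L K hK (fun _ => r / K * Real.log ρ)] at hlt2
      refine lt_of_lt_of_le hlt2 (le_of_eq ?_)
      simp only [Finset.sum_const, Finset.card_range, nsmul_eq_mul]
      field_simp
    refine le_trans ?_ (measure_mono hsub)
    rw [Measure.pi_pi]
    have e : ∀ l : Fin L, gM n m (if (l : ℕ) < K then S else Set.univ) =
        if (l : ℕ) < K then gM n m S else 1 := by
      intro l; split_ifs <;> simp
    simp_rw [e]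
    rw [prod_fin_ite L K hK]
    refine le_trans (le_of_eq ?_) (pow_le_pow_left' h K)
    rw [← ENNReal.ofReal_pow (by positivity), ← Real.rpow_mul_natCast hρ0.le]
    congr 2
    rw [ldmtDiv, if_neg hKpos.ne']
    field_simp

theorem up2 (L n m K M : ℕ) (hK : K ≤ L) (hM : 0 < M) (r : ℝ) (hr : 0 < r)
    (ε : ℝ) (hε : 0 < ε) :
    ∀ᶠ ρ : ℝ in Filter.atTop, (Measure.pi fun _ : Fin L => gM n m) (GE L n m K M ρ (r * Real.log ρ)) ≤
      ENNReal.ofReal (ρ ^ (-(ldmtDiv m n r K) + ε)) := by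
  have triv : ldmtDiv m n r K = 0 → ∀ᶠ ρ : ℝ in Filter.atTop,
      (Measure.pi fun _ : Fin L => gM n m) (GE L n m K M ρ (r * Real.log ρ)) ≤
      ENNReal.ofReal (ρ ^ (-(ldmtDiv m n r K) + ε)) := by
    intro h
    filter_upwards [Filter.eventually_gt_atTop 1] with ρ hρ
    refine prob_le_one.trans ?_
    rw [h, ENNReal.one_le_ofReal]
    exact Real.one_le_rpow hρ.le (by linarith)
  rcases Nat.eq_zero_or_pos K with rfl | hKpos
  · exact triv (by simp [ldmtDiv])
  by_cases hx : ((min m n : ℕ) : ℝ) ≤ r / K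
  · exact triv (by simp only [ldmtDiv, dmt, if_pos hx]; simp)
  have hx' : r / K < ((min n m : ℕ) : ℝ) := by rw [min_comm]; exact not_le.1 hx
  have hKr : (0 : ℝ) < K := by exact_mod_cast hKpos
  have hMr : (1 : ℝ) ≤ M := by exact_mod_cast hM
  obtain ⟨C, hC, h⟩ := up1 n m (r / K) (by positivity) hx' (ε / (2 * K)) (by positivity)
  set x := r / K with hxd
  have hxK : (K : ℝ) * x = r := by rw [hxd]; field_simp
  have hs : 0 ≤ (n : ℝ) + m - 2 * ⌊x⌋₊ - 1 := by
    have hk : ⌊x⌋₊ < min n m := (Nat.floor_lt (by positivity)).2 hx'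
    have : 2 * ⌊x⌋₊ + 1 ≤ n + m := by omega
    have : ((2 * ⌊x⌋₊ + 1 : ℕ) : ℝ) ≤ (n + m : ℕ) := by exact_mod_cast this
    push_cast at this
    linarith
  set s := (n : ℝ) + m - 2 * ⌊x⌋₊ - 1 with hsd
  set E := -(dmt m n x + s * x) + ε / (2 * K) with hE
  have hld : ldmtDiv m n r K = K * dmt m n x := by rw [ldmtDiv, if_neg hKpos.ne']
  filter_upwards [ev_rpow_ge ((C * ((M : ℝ) ^ E)⁻¹) ^ K) (ε / 2) (by positivity),
    Filter.eventually_gt_atTop 1, Filter.eventually_ge_atTop (M : ℝ)] with ρ h1 hρ hρM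
  have hρ0 : 0 < ρ := by linarith
  have hM0 : (0 : ℝ) < M := by linarith
  have hb := h (ρ / M) ((one_le_div hM0).2 hρM)
  have hmD : Measurable fun H : Fin n → Fin m → ℂ => Dg (ρ / M) (Matrix.of H) := (continuous_Dg _).measurable
  -- Chernoff
  have hch : (Measure.pi fun _ : Fin L => gM n m) (GE L n m K M ρ (r * Real.log ρ)) ≤
      ∫⁻ g, ENNReal.ofReal (ρ ^ (s * r)) * ∏ l : Fin L, (if (l : ℕ) < K then
        ENNReal.ofReal (Dg (ρ / M) (Matrix.of (g l)) ^ (-s)) else 1) ∂(Measure.pi fun _ : Fin L => gM n m) := by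
    rw [← lintegral_indicator_one (meas_GE _ _ _ _ _ _ _)]
    refine lintegral_mono fun g => ?_
    by_cases hg : g ∈ GE L n m K M ρ (r * Real.log ρ)
    · rw [Set.indicator_of_mem hg, Pi.one_apply]
      have hD : ∀ l, 0 < Dg (ρ / M) (Matrix.of (g l)) := fun l =>
        lt_of_lt_of_le zero_lt_one (one_le_Dg (by positivity) _)
      have e1 : ∀ l : Fin L, (if (l : ℕ) < K then
          ENNReal.ofReal (Dg (ρ / M) (Matrix.of (g l)) ^ (-s)) else 1) =
          ENNReal.ofReal (Real.exp (-s * (if (l : ℕ) < K then Real.log (Dg (ρ / M) (Matrix.of (g l))) else 0))) := by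
        intro l
        split_ifs
        · rw [Real.rpow_def_of_pos (hD l), mul_comm]
        · simp
      simp_rw [e1]
      rw [← ENNReal.ofReal_prod_of_nonneg fun _ _ => (Real.exp_pos _).le, ← Real.exp_sum,
        ← ENNReal.ofReal_mul (by positivity), ← Finset.mul_sum, ENNReal.one_le_ofReal,
        Real.rpow_def_of_pos hρ0, ← Real.exp_add, Real.one_le_exp_iff]
      have hg' : ∑ l : Fin L, (if (l : ℕ) < K then Real.log (Dg (ρ / M) (Matrix.of (g l))) else 0) <
        r * Real.log ρ := hg
      nlinarith
    · rw [Set.indicator_of_notMem hg]; simp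
  refine hch.trans ?_
  have hmi : ∀ l : Fin L, Measurable (fun H : Fin n → Fin m → ℂ => if (l : ℕ) < K then
        ENNReal.ofReal (Dg (ρ / M) (Matrix.of H) ^ (-s)) else 1) := by
    intro l
    split_ifs <;> fun_prop
  have hmp : Measurable (fun g : Fin L → Fin n → Fin m → ℂ => ∏ l : Fin L, (if (l : ℕ) < K then
        ENNReal.ofReal (Dg (ρ / M) (Matrix.of (g l)) ^ (-s)) else 1)) :=
    Finset.measurable_prod _ fun l _ => (hmi l).comp (measurable_pi_apply l)
  rw [lintegral_const_mul _ hmp,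
    lint_pi_fin (gM n m) L (fun l H => if (l : ℕ) < K then
        ENNReal.ofReal (Dg (ρ / M) (Matrix.of H) ^ (-s)) else 1) hmi]
  have e2 : ∀ l : Fin L, ∫⁻ H, (if (l : ℕ) < K then
        ENNReal.ofReal (Dg (ρ / M) (Matrix.of H) ^ (-s)) else 1) ∂(gM n m) = if (l : ℕ) < K then
        ∫⁻ H, ENNReal.ofReal (Dg (ρ / M) (Matrix.of H) ^ (-s)) ∂(gM n m) else 1 := by
    intro l; split_ifs <;> simp
  simp_rw [e2]
  rw [prod_fin_ite L K hK]
  refine (mul_le_mul' le_rfl (pow_le_pow_left' hb K)).trans ?_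
  rw [← ENNReal.ofReal_pow (by positivity), ← ENNReal.ofReal_mul (by positivity)]
  apply ENNReal.ofReal_le_ofReal
  rw [Real.div_rpow hρ0.le hM0.le, hld]
  have hEK : E * K = -(K * dmt m n x) - s * r + ε / 2 := by
    rw [hE, ← hxK]; field_simp; ring
  calc ρ ^ (s * r) * (C * (ρ ^ E / (M : ℝ) ^ E)) ^ K
      = ((C * ((M : ℝ) ^ E)⁻¹) ^ K) * (ρ ^ (s * r) * ρ ^ (E * K)) := by
        rw [Real.rpow_mul_natCast hρ0.le, div_eq_mul_inv]; ring
    _ ≤ ρ ^ (ε / 2) * (ρ ^ (s * r) * ρ ^ (E * K)) := by gcongr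
    _ = _ := by
        rw [← Real.rpow_add hρ0, ← Real.rpow_add hρ0, hEK]; congr 1; ring

end OneChannel



theorem lt_decTime (L : ℕ) (C : ℕ → ℝ) (hC : ∀ l, 0 ≤ C l) (R : ℝ) (hR : 0 < R) (K : ℕ) (hK : K ≤ L) :
    (K : ℕ∞) < decTimeST L C R ↔ ∑ l ∈ Finset.range K, C l < R := by
  constructor
  · intro h
    by_contra hcon
    rw [not_lt] at hcon
    have hK1 : 1 ≤ K := by
      rcases Nat.eq_zero_or_pos K with rfl | h
      · simp at hcon; linarith
      · exact h
    have : decTimeST L C R ≤ K := sInf_le ⟨K, rfl, hK1, hK, hcon⟩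
    exact absurd h (not_lt.2 this)
  · intro h
    have h1 : ((K + 1 : ℕ) : ℕ∞) ≤ decTimeST L C R := by
      refine le_sInf ?_
      rintro t ⟨n, rfl, hn1, hnL, hn⟩
      rw [Nat.cast_le]
      by_contra hcon
      have hle : n ≤ K := by omega
      have : ∑ l ∈ Finset.range n, C l ≤ ∑ l ∈ Finset.range K, C l :=
        Finset.sum_le_sum_of_subset_of_nonneg (Finset.range_subset_range.2 hle) fun i _ _ => hC i
      linarith
    refine lt_of_lt_of_le ?_ h1
    exact_mod_cast Nat.lt_succ_self K

theorem enat_split (L : ℕ) (hL : 1 ≤ L) (t1 t2 : ℕ∞) (h1 : 0 < t1) (h2 : 0 < t2) :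
    (L : ℕ∞) < t1 + t2 ↔ ∃ p ∈ Finset.HasAntidiagonal.antidiagonal (L - 1), (p.1 : ℕ∞) < t1 ∧ (p.2 : ℕ∞) < t2 := by
  constructor
  · intro h
    induction t1 using ENat.recTopCoe with
    | top => exact ⟨(L - 1, 0), by simp, ENat.coe_lt_top _, by simpa using h2⟩
    | coe a =>
      have ha : 0 < a := by exact_mod_cast h1
      rcases le_or_gt a L with haL | haL
      · refine ⟨(a - 1, L - a), by simp; omega, by simp only [Nat.cast_lt]; omega, ?_⟩
        induction t2 using ENat.recTopCoe with
        | top => exact ENat.coe_lt_top _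
        | coe b =>
          have : L < a + b := by exact_mod_cast h
          simp only [Nat.cast_lt]
          omega
      · exact ⟨(L - 1, 0), by simp, by simp only [Nat.cast_lt]; omega, by simpa using h2⟩
  · rintro ⟨p, hp, hp1, hp2⟩
    rw [Finset.HasAntidiagonal.mem_antidiagonal] at hp
    have a1 : ((p.1 + 1 : ℕ) : ℕ∞) ≤ t1 := by
      push_cast; exact Order.add_one_le_of_lt hp1
    have a2 : ((p.2 + 1 : ℕ) : ℕ∞) ≤ t2 := by
      push_cast; exact Order.add_one_le_of_lt hp2
    refine lt_of_lt_of_le ?_ (add_le_add a1 a2)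
    have : L < (p.1 + 1) + (p.2 + 1) := by omega
    exact_mod_cast this

theorem cap_eq {a b : ℕ} (M : ℕ) (ρ : ℝ) (H : Matrix (Fin a) (Fin b) ℂ) :
    cap M ρ H = Real.log (Dg (ρ / M) (Matrix.of fun i j => H i j)) := rfl

theorem cap_nonneg {a b : ℕ} (M : ℕ) (ρ : ℝ) (hρ : 0 ≤ ρ) (H : Matrix (Fin a) (Fin b) ℂ) :
    0 ≤ cap M ρ H := by
  rw [cap_eq]
  exact Real.log_nonneg (one_le_Dg (by positivity) _)

theorem final_limit (p : ℝ → ENNReal) (E : ℝ) (hp : ∀ ρ, p ρ ≤ 1)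
    (hlow : ∀ ε > 0, ∀ᶠ ρ : ℝ in Filter.atTop, ENNReal.ofReal (ρ ^ (-E - ε)) ≤ p ρ)
    (hup : ∀ ε > 0, ∀ᶠ ρ : ℝ in Filter.atTop, p ρ ≤ ENNReal.ofReal (ρ ^ (-E + ε))) :
    Filter.Tendsto (fun ρ : ℝ => Real.log (p ρ).toReal / Real.log ρ) Filter.atTop (nhds (-E)) := by
  rw [Metric.tendsto_nhds]
  intro ε hε
  filter_upwards [hlow (ε / 2) (by positivity), hup (ε / 2) (by positivity),
    Filter.eventually_gt_atTop 1] with ρ h1 h2 hρ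
  have hρ0 : 0 < ρ := by linarith
  have hlog := Real.log_pos hρ
  have hfin : p ρ ≠ ⊤ := ((hp ρ).trans_lt ENNReal.one_lt_top).ne
  have g1 : ρ ^ (-E - ε / 2) ≤ (p ρ).toReal := (ENNReal.ofReal_le_iff_le_toReal hfin).1 h1
  have g2 : (p ρ).toReal ≤ ρ ^ (-E + ε / 2) := ENNReal.toReal_le_of_le_ofReal (by positivity) h2
  have hpos : 0 < ρ ^ (-E - ε / 2) := by positivity
  have k1 := Real.log_le_log hpos g1
  have k2 := Real.log_le_log (lt_of_lt_of_le hpos g1) g2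
  rw [Real.log_rpow hρ0] at k1 k2
  rw [← le_div_iff₀ hlog] at k1
  rw [← div_le_iff₀ hlog] at k2
  rw [Real.dist_eq, abs_lt]
  constructor <;> linarith


/-- **Theorem 5** (DMDT of the FBL ARQ protocol, three-node network, short-term static
channel): with mutually independent standard complex Gaussian matrices `H_{i,l}`
(`i = 1, 2`, `l = 1, ..., L`), the probability `P(t₁(ρ) + t₂(ρ) > L)` has SNR exponent
`- min { l1 d^{(M1,M2)}(r/l1) + l2 d^{(M2,M3)}(r/l2) : l1 + l2 = L - 1 }`,
with the convention `0 · d^{(m,n)}(r/0) := 0`. -/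
theorem FBL_DMDT_threeNode_shortTerm
    {Ω : Type*} [MeasurableSpace Ω] (P : Measure Ω) [IsProbabilityMeasure P]
    (M1 M2 M3 : ℕ) (hM1 : 0 < M1) (hM2 : 0 < M2) (hM3 : 0 < M3)
    (L : ℕ) (hL : 2 ≤ L) (r : ℝ) (hr : 0 < r)
    (H1 : ℕ → Ω → Matrix (Fin M2) (Fin M1) ℂ) (H2 : ℕ → Ω → Matrix (Fin M3) (Fin M2) ℂ)
    (hGauss : Measure.map
      (fun ω (p : ((Fin L × Fin M2 × Fin M1) ⊕ (Fin L × Fin M3 × Fin M2)) × Bool) =>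
        Sum.elim
          (fun q => if p.2 then (H1 q.1 ω q.2.1 q.2.2).re else (H1 q.1 ω q.2.1 q.2.2).im)
          (fun q => if p.2 then (H2 q.1 ω q.2.1 q.2.2).re else (H2 q.1 ω q.2.1 q.2.2).im)
          p.1) P
      = Measure.pi (fun _ => gaussianReal 0 (1/2))) :
    Filter.Tendsto (fun ρ : ℝ =>
        Real.log ((P {ω | decTimeST L (fun l => cap M1 ρ (H1 l ω)) (r * Real.log ρ)
                          + decTimeST L (fun l => cap M2 ρ (H2 l ω)) (r * Real.log ρ)
                          > (L : ℕ∞)}).toReal)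
          / Real.log ρ)
      Filter.atTop
      (nhds (-(sInf {x : ℝ | ∃ l1 l2 : ℕ, l1 + l2 = L - 1 ∧
          x = ldmtDiv M1 M2 r l1 + ldmtDiv M2 M3 r l2}))) := by
  obtain ⟨hae, hlaw⟩ := law_main P M1 M2 M3 L H1 H2 hGauss
  set μ1 : Measure (Fin L → Fin M2 → Fin M1 → ℂ) := Measure.pi fun _ => gM M2 M1
  set μ2 : Measure (Fin L → Fin M3 → Fin M2 → ℂ) := Measure.pi fun _ => gM M3 M2
  set T := {x : ℝ | ∃ l1 l2 : ℕ, l1 + l2 = L - 1 ∧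
          x = ldmtDiv M1 M2 r l1 + ldmtDiv M2 M3 r l2} with hT
  have hTfin : T.Finite := by
    have : T = (fun p : ℕ × ℕ => ldmtDiv M1 M2 r p.1 + ldmtDiv M2 M3 r p.2) ''
        (Finset.HasAntidiagonal.antidiagonal (L - 1) : Set (ℕ × ℕ)) := by
      ext x
      constructor
      · rintro ⟨l1, l2, h, rfl⟩
        exact ⟨(l1, l2), by simpa using h, rfl⟩
      · rintro ⟨p, hp, rfl⟩
        exact ⟨p.1, p.2, by simpa using hp, rfl⟩
    rw [this]
    exact (Finset.finite_toSet _).image _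
  have hTne : T.Nonempty := ⟨_, 0, L - 1, by omega, rfl⟩
  have hle : ∀ p ∈ Finset.HasAntidiagonal.antidiagonal (L - 1), sInf T ≤ ldmtDiv M1 M2 r p.1 + ldmtDiv M2 M3 r p.2 :=
    fun p hp => csInf_le hTfin.bddBelow ⟨p.1, p.2, by simpa using hp, rfl⟩
  -- the event
  have hev : ∀ ρ : ℝ, 1 < ρ → P {ω | decTimeST L (fun l => cap M1 ρ (H1 l ω)) (r * Real.log ρ)
                          + decTimeST L (fun l => cap M2 ρ (H2 l ω)) (r * Real.log ρ)
                          > (L : ℕ∞)} =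
      (μ1.prod μ2) (⋃ p ∈ Finset.HasAntidiagonal.antidiagonal (L - 1), GE L M2 M1 p.1 M1 ρ (r * Real.log ρ) ×ˢ
        GE L M3 M2 p.2 M2 ρ (r * Real.log ρ)) := by
    intro ρ hρ
    have hR : 0 < r * Real.log ρ := mul_pos hr (Real.log_pos hρ)
    rw [← hlaw, Measure.map_apply_of_aemeasurable hae (Finset.measurableSet_biUnion _ fun p _ =>
      (meas_GE _ _ _ _ _ _ _).prod (meas_GE _ _ _ _ _ _ _))]
    congr 1
    ext ω
    have c1 : ∀ l, 0 ≤ (fun l => cap M1 ρ (H1 l ω)) l := fun l => cap_nonneg _ _ (by linarith) _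
    have c2 : ∀ l, 0 ≤ (fun l => cap M2 ρ (H2 l ω)) l := fun l => cap_nonneg _ _ (by linarith) _
    have p1 : 0 < decTimeST L (fun l => cap M1 ρ (H1 l ω)) (r * Real.log ρ) := by
      have := (lt_decTime L _ c1 _ hR 0 (by omega)).2 (by simpa using hR)
      simpa using this
    have p2 : 0 < decTimeST L (fun l => cap M2 ρ (H2 l ω)) (r * Real.log ρ) := by
      have := (lt_decTime L _ c2 _ hR 0 (by omega)).2 (by simpa using hR)
      simpa using this
    have key := enat_split L (by omega) _ _ p1 p2
    change (L : ℕ∞) < _ ↔ _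
    rw [key]
    simp only [Set.mem_preimage, Set.mem_iUnion, exists_prop]
    refine exists_congr fun p => and_congr_right fun hp => ?_
    have hp' : p.1 + p.2 = L - 1 := by simpa using hp
    rw [lt_decTime L _ c1 _ hR p.1 (by omega), lt_decTime L _ c2 _ hR p.2 (by omega), Set.mem_prod,
      ← sum_fin_ite L p.1 (by omega), ← sum_fin_ite L p.2 (by omega)]
    exact Iff.rfl
  apply final_limit _ _ (fun ρ => prob_le_one)
  · intro ε hε
    obtain ⟨l1, l2, hl, hmin⟩ := hTne.csInf_mem hTfin
    filter_upwards [low2 L M2 M1 l1 M1 hM2 hM1 (by omega) hM1 r hr (ε / 2) (by positivity),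
      low2 L M3 M2 l2 M2 hM3 hM2 (by omega) hM2 r hr (ε / 2) (by positivity),
      Filter.eventually_gt_atTop 1] with ρ h1 h2 hρ
    have hρ0 : 0 < ρ := by linarith
    rw [hev ρ hρ]
    calc ENNReal.ofReal (ρ ^ (-sInf T - ε)) = ENNReal.ofReal (ρ ^ (-(ldmtDiv M1 M2 r l1) - ε / 2)) *
          ENNReal.ofReal (ρ ^ (-(ldmtDiv M2 M3 r l2) - ε / 2)) := by
          rw [← ENNReal.ofReal_mul (by positivity), ← Real.rpow_add hρ0, hmin]
          congr 2; ring
      _ ≤ _ := mul_le_mul' h1 h2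
      _ = (μ1.prod μ2) (GE L M2 M1 l1 M1 ρ (r * Real.log ρ) ×ˢ GE L M3 M2 l2 M2 ρ (r * Real.log ρ)) :=
          (Measure.prod_prod _ _).symm
      _ ≤ _ := by
          apply measure_mono
          exact Set.subset_biUnion_of_mem (u := fun p : ℕ × ℕ => GE L M2 M1 p.1 M1 ρ (r * Real.log ρ) ×ˢ
            GE L M3 M2 p.2 M2 ρ (r * Real.log ρ)) (x := (l1, l2))
            (show (l1, l2) ∈ Finset.HasAntidiagonal.antidiagonal (L - 1) by simpa using hl)
  · intro ε hε
    have hall : ∀ᶠ ρ : ℝ in Filter.atTop, ∀ p ∈ Finset.HasAntidiagonal.antidiagonal (L - 1),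
        μ1 (GE L M2 M1 p.1 M1 ρ (r * Real.log ρ)) ≤ ENNReal.ofReal (ρ ^ (-(ldmtDiv M1 M2 r p.1) + ε / 4)) ∧
        μ2 (GE L M3 M2 p.2 M2 ρ (r * Real.log ρ)) ≤ ENNReal.ofReal (ρ ^ (-(ldmtDiv M2 M3 r p.2) + ε / 4)) := by
      rw [Filter.eventually_all_finset]
      intro p hp
      have hp' : p.1 + p.2 = L - 1 := by simpa using hp
      exact (up2 L M2 M1 p.1 M1 (by omega) hM1 r hr (ε / 4) (by positivity)).and
        (up2 L M3 M2 p.2 M2 (by omega) hM2 r hr (ε / 4) (by positivity))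
    filter_upwards [hall, ev_rpow_ge ((L - 1 + 1 : ℕ) : ℝ) (ε / 2) (by positivity),
      Filter.eventually_gt_atTop 1] with ρ h hc hρ
    have hρ0 : 0 < ρ := by linarith
    rw [hev ρ hρ]
    refine (measure_biUnion_finset_le _ _).trans ?_
    calc _ ≤ ∑ p ∈ Finset.HasAntidiagonal.antidiagonal (L - 1), ENNReal.ofReal (ρ ^ (-sInf T + ε / 2)) := by
          refine Finset.sum_le_sum fun p hp => ?_
          rw [Measure.prod_prod]
          refine (mul_le_mul' (h p hp).1 (h p hp).2).trans ?_
          rw [← ENNReal.ofReal_mul (by positivity), ← Real.rpow_add hρ0]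
          apply ENNReal.ofReal_le_ofReal
          apply Real.rpow_le_rpow_of_exponent_le hρ.le
          linarith [hle p hp]
      _ = ENNReal.ofReal (((L - 1 + 1 : ℕ) : ℝ) * ρ ^ (-sInf T + ε / 2)) := by
          rw [Finset.sum_const, Finset.Nat.card_antidiagonal, nsmul_eq_mul,
            ENNReal.ofReal_mul (by positivity), ENNReal.ofReal_natCast]
      _ ≤ ENNReal.ofReal (ρ ^ (ε / 2) * ρ ^ (-sInf T + ε / 2)) := by
          apply ENNReal.ofReal_le_ofReal
          gcongr
      _ = _ := by
          rw [← Real.rpow_add hρ0]; congr 2; ring
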